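/- arXiv:math/9806078 — 3 statements merged into one kernel-verified Lean document; each statement's English description precedes it below -/
import Mathlib

section
/- Suppose the meromorphic mapping Φ = (φ₁,…,φ_n) admits an algebraic addition theorem. Then any n+1 functions chosen from the n²+n functions φ₁(u),…,φ_n(u) and ∂φ_k/∂u_p(u) (k,p = 1,…,n) are algebraically dependent: for any such choice ψ₁,…,ψ_{n+1} there exists a nonzero polynomial W ∈ ℂ[t₁,…,t_{n+1}] such that W(ψ₁(u),…,ψ_{n+1}(u)) = 0 for every u at which all of φ₁,…,φ_n and their first-order partial derivatives are analytic. -/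
open MvPolynomial

/-- The partial derivative `∂f/∂u_p` of a function on ℂⁿ. -/
noncomputable def pd {n : ℕ} (f : (Fin n → ℂ) → ℂ) (p : Fin n) (u : Fin n → ℂ) : ℂ :=
  fderiv ℂ f u (Pi.single p 1)

/-- `f` is meromorphic on ℂⁿ: a quotient of two everywhere-analytic functions. -/
def Mero {n : ℕ} (f : (Fin n → ℂ) → ℂ) : Prop :=
  ∃ g h : (Fin n → ℂ) → ℂ, (∀ u, AnalyticAt ℂ g u) ∧ (∀ u, AnalyticAt ℂ h u) ∧
    (∃ u, h u ≠ 0) ∧ ∀ u, h u ≠ 0 → f u = g u / h u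

/-- The Jacobian determinant of the family `φ` is not identically zero. -/
def AnalyticallyIndep {n : ℕ} (φ : Fin n → (Fin n → ℂ) → ℂ) : Prop :=
  ∃ u : Fin n → ℂ, (∀ j, AnalyticAt ℂ (φ j) u) ∧
    Matrix.det (Matrix.of fun k p => pd (φ k) p u) ≠ 0

/-- `Φ = (φ₁,…,φ_n)` admits an algebraic addition theorem: for each `k` there is a
polynomial `G_k` in the variables `λ` (= `none`), `x_j` (= `some (inl j)`) and
`y_j` (= `some (inr j)`), of degree ≥ 1 in `λ`, with
`G_k(φ_k(u+v); φ(u), φ(v)) = 0` wherever all functions involved are analytic. -/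
def AdmitsAAT {n : ℕ} (φ : Fin n → (Fin n → ℂ) → ℂ) : Prop :=
  ∀ k : Fin n, ∃ G : MvPolynomial (Option (Fin n ⊕ Fin n)) ℂ,
    1 ≤ G.degreeOf none ∧
    ∀ u v : Fin n → ℂ, (∀ j, AnalyticAt ℂ (φ j) u) → (∀ j, AnalyticAt ℂ (φ j) v) →
      AnalyticAt ℂ (φ k) (u + v) →
      eval (fun i => i.elim (φ k (u + v)) (Sum.elim (fun j => φ j u) fun j => φ j v)) G = 0

/-- The valuation sending the variable `none` to `θ(u)` and `some j` to `φ_j(u)`. -/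
noncomputable def tval {n : ℕ} (θ : (Fin n → ℂ) → ℂ) (φ : Fin n → (Fin n → ℂ) → ℂ)
    (u : Fin n → ℂ) : Option (Fin n) → ℂ :=
  fun i => i.elim (θ u) fun j => φ j u

/-- `f` is a rational function on ℂⁿ. -/
def RatFn {n : ℕ} (f : (Fin n → ℂ) → ℂ) : Prop :=
  ∃ P Q : MvPolynomial (Fin n) ℂ, Q ≠ 0 ∧
    ∃ s : Set (Fin n → ℂ), IsOpen s ∧ s.Nonempty ∧
      ∀ u ∈ s, f u = eval u P / eval u Q

section Helpers
open Filter Topology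

theorem hp_mul_zero {E : Type*} [NormedAddCommGroup E] [NormedSpace ℂ E] {f g : E → ℂ} {x : E}
    (hf : AnalyticAt ℂ f x) (hg : AnalyticAt ℂ g x) (h : ∀ᶠ u in 𝓝 x, f u * g u = 0) :
    (∀ᶠ u in 𝓝 x, f u = 0) ∨ ∀ᶠ u in 𝓝 x, g u = 0 := by
  have h3 := (hf.eventually_analyticAt.and hg.eventually_analyticAt).and h
  obtain ⟨r, hr, hB⟩ := Metric.eventually_nhds_iff_ball.1 h3
  by_cases hz : ∀ u ∈ Metric.ball x r, f u = 0
  · left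
    exact Metric.eventually_nhds_iff_ball.2 ⟨r, hr, hz⟩
  · right
    push Not at hz
    obtain ⟨y, hy, hfy⟩ := hz
    have hgy : g =ᶠ[𝓝 y] 0 := by
      have h1 : ∀ᶠ u in 𝓝 y, f u ≠ 0 := (hB y hy).1.1.continuousAt.eventually_ne hfy
      filter_upwards [h1, Metric.isOpen_ball.mem_nhds hy] with u hu hu2
      exact (mul_eq_zero.1 (hB u hu2).2).resolve_left hu
    have hgB : AnalyticOnNhd ℂ g (Metric.ball x r) := fun u hu => (hB u hu).1.2
    have := hgB.eqOn_zero_of_preconnected_of_eventuallyEq_zero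
      ((convex_ball x r).isPreconnected) hy hgy
    exact Metric.eventually_nhds_iff_ball.2 ⟨r, hr, fun u hu => this hu⟩

theorem hp_prod_zero {E : Type*} [NormedAddCommGroup E] [NormedSpace ℂ E] {ι : Type*}
    (s : Finset ι) {f : ι → E → ℂ} {x : E}
    (hf : ∀ i, AnalyticAt ℂ (f i) x) (h : ∀ i, ¬ ∀ᶠ u in 𝓝 x, f i u = 0) :
    ¬ ∀ᶠ u in 𝓝 x, ∏ i ∈ s, f i u = 0 := by
  classical
  induction s using Finset.induction_on with
  | empty => simp [NeBot.ne]
  | insert a s ha ih =>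
    intro H
    simp_rw [Finset.prod_insert ha] at H
    rcases hp_mul_zero (hf a) (Finset.analyticAt_fun_prod s fun i _ => hf i) H with h1 | h1
    · exact h a h1
    · exact ih h1

theorem hp_analytic_eval {E : Type*} [NormedAddCommGroup E] [NormedSpace ℂ E] {σ : Type*}
    {f : E → σ → ℂ} {x : E}
    (hf : ∀ i, AnalyticAt ℂ (fun u => f u i) x) (P : MvPolynomial σ ℂ) :
    AnalyticAt ℂ (fun u => eval (f u) P) x := by
  have := AnalyticAt.aeval_mvPolynomial hf P
  simpa [MvPolynomial.aeval_eq_eval] using this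

theorem hp_hasDerivAt_eval {σ : Type*} [Fintype σ] (P : MvPolynomial σ ℂ) {f : ℂ → σ → ℂ}
    {f' : σ → ℂ} {t : ℂ} (hf : ∀ i, HasDerivAt (fun t => f t i) (f' i) t) :
    HasDerivAt (fun t => eval (f t) P) (∑ i, eval (f t) (pderiv i P) * f' i) t := by
  classical
  induction P using MvPolynomial.induction_on with
  | C a => simpa using hasDerivAt_const t a
  | add p q hp hq =>
    simpa [add_mul, Finset.sum_add_distrib] using hp.fun_add hq
  | mul_X p i hp =>
    have := hp.fun_mul (hf i)
    have e : (fun t => eval (f t) (p * X i)) = fun t => eval (f t) p * f t i := by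
      funext t; simp
    rw [e]
    refine this.congr_deriv (Eq.symm ?_)
    simp only [pderiv_mul, pderiv_X, map_add, map_mul, eval_X, add_mul, Finset.sum_add_distrib,
      Finset.sum_mul]
    congr 1
    · exact Finset.sum_congr rfl fun j _ => by ring
    · rw [Finset.sum_eq_single i]
      · simp
      · intro j _ hj
        simp [hj.symm]
      · simp

theorem hp_degreeOf_pderiv {σ : Type*} (i : σ) (p : MvPolynomial σ ℂ) (h : p.degreeOf i ≠ 0) :
    pderiv i p ≠ 0 ∧ (pderiv i p).degreeOf i < p.degreeOf i := by
  classical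
  constructor
  · intro h0
    have : p.degreeOf i < 1 := by
      rw [degreeOf_lt_iff one_pos]
      intro m hm
      by_contra hlt
      have hc := coeff_pderiv (i := i) p (m - Finsupp.single i 1)
      rw [h0, tsub_add_cancel_of_le (by
        rw [Finsupp.single_le_iff]; omega)] at hc
      simp only [coeff_zero] at hc
      rcases mul_eq_zero.1 hc.symm with h1 | h1
      · exact (mem_support_iff.1 hm) h1
      · exact Nat.cast_add_one_ne_zero _ h1
    omega
  · rw [degreeOf_lt_iff (Nat.pos_of_ne_zero h)]
    intro m hm
    rw [mem_support_iff, coeff_pderiv] at hm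
    have hm2 : m + Finsupp.single i 1 ∈ p.support := by
      rw [mem_support_iff]; exact left_ne_zero_of_mul hm
    have := monomial_le_degreeOf i hm2
    simp at this
    omega

theorem hp_derivative_aeval {σ S : Type*} [CommRing S] [Algebra ℂ S] (g : σ → S)
    (G : MvPolynomial (Option σ) ℂ) :
    Polynomial.derivative (aeval (fun i : Option σ => i.elim (Polynomial.X : Polynomial S)
      fun s => Polynomial.C (g s)) G) =
    aeval (fun i : Option σ => i.elim (Polynomial.X : Polynomial S)
      fun s => Polynomial.C (g s)) (pderiv none G) := by
  classical
  induction G using MvPolynomial.induction_on with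
  | C a => simp [Polynomial.algebraMap_apply]
  | add p q hp hq => simp [hp, hq]
  | mul_X p i hp =>
    simp only [map_mul, Polynomial.derivative_mul, hp, pderiv_mul, map_add, aeval_X, pderiv_X]
    cases i <;> simp

theorem hp_isAlgebraic {σ S A : Type*} [CommRing S] [Algebra ℂ S] [CommRing A] [Algebra ℂ A]
    [Algebra S A] [IsScalarTower ℂ S A] (g : σ → S) (F : A) (G : MvPolynomial (Option σ) ℂ)
    (h0 : aeval (fun i : Option σ => i.elim F fun s => algebraMap S A (g s)) G = 0)
    (h1 : aeval (fun i : Option σ => i.elim F fun s => algebraMap S A (g s)) (pderiv none G) ≠ 0) :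
    IsAlgebraic S F := by
  have key : ∀ H : MvPolynomial (Option σ) ℂ,
      Polynomial.aeval F (aeval (fun i : Option σ => i.elim (Polynomial.X : Polynomial S)
      fun s => Polynomial.C (g s)) H) =
      aeval (fun i : Option σ => i.elim F fun s => algebraMap S A (g s)) H := by
    intro H
    have := MvPolynomial.comp_aeval_apply (fun i : Option σ => i.elim (Polynomial.X : Polynomial S)
      fun s => Polynomial.C (g s)) ((Polynomial.aeval F : Polynomial S →ₐ[S] A).restrictScalars ℂ) H
    simp only [AlgHom.restrictScalars_apply] at this
    rw [this]
    congr 2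
    funext i
    cases i <;> simp
  refine ⟨_, ?_, (key G).trans h0⟩
  intro hP
  apply h1
  rw [← key, ← hp_derivative_aeval, hP]
  simp

theorem hp_dependent {A : Type} [CommRing A] [IsDomain A] [Algebra ℂ A] {n : ℕ}
    (x : Fin n → A) (y : Fin (n + 1) → A)
    (h : ∀ i, IsAlgebraic (Algebra.adjoin ℂ (Set.range x)) (y i)) :
    ¬ AlgebraicIndependent ℂ y := by
  intro hy
  have h1 : (AlgebraicIndependent.matroid ℂ A).Indep (Set.range y) := by
    rw [AlgebraicIndependent.matroid_indep_iff]
    exact hy.coe_range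
  have h2 : Set.range y ⊆ (AlgebraicIndependent.matroid ℂ A).closure (Set.range x) := by
    rw [AlgebraicIndependent.matroid_closure_eq]
    rintro _ ⟨i, rfl⟩
    exact h i
  have h3 := h1.encard_le_eRk_of_subset h2
  rw [Matroid.eRk_closure_eq] at h3
  have h4 := h3.trans (Matroid.eRk_le_encard _ _)
  rw [← Set.image_univ, ← Set.image_univ, hy.injective.encard_image] at h4
  have h5 := h4.trans (Set.encard_image_le _ _)
  simp [Set.encard_univ] at h5
  exact absurd h5 (by exact_mod_cast (by omega : ¬ (n + 1 ≤ n)))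

theorem hp_alg_aeval {σ S A : Type*} [CommRing S] [IsDomain S] [Algebra ℂ S] [CommRing A]
    [Algebra ℂ A] [Algebra S A] [IsScalarTower ℂ S A] (q : σ → A) (hq : ∀ i, IsAlgebraic S (q i))
    (H : MvPolynomial σ ℂ) : IsAlgebraic S (aeval q H) := by
  induction H using MvPolynomial.induction_on with
  | C a =>
    rw [aeval_C, IsScalarTower.algebraMap_apply ℂ S A]
    exact isAlgebraic_algebraMap _
  | add p r hp hr => rw [map_add]; exact hp.add hr
  | mul_X p i hp => rw [map_mul, aeval_X]; exact hp.mul (hq i)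

/-- Polynomials whose value along `f` vanishes near `x`. -/
def hpIdeal {E τ : Type*} [TopologicalSpace E] (f : E → τ → ℂ) (x : E) :
    Ideal (MvPolynomial τ ℂ) where
  carrier := {P | ∀ᶠ u in 𝓝 x, eval (f u) P = 0}
  add_mem' := by
    intro a b ha hb
    filter_upwards [ha, hb] with u h1 h2
    simp [h1, h2]
  zero_mem' := by simp
  smul_mem' := by
    intro c a ha
    filter_upwards [ha] with u h1
    simp [h1]

theorem hp_mem_ideal {E τ : Type*} [TopologicalSpace E] (f : E → τ → ℂ) (x : E)
    (P : MvPolynomial τ ℂ) : P ∈ hpIdeal f x ↔ ∀ᶠ u in 𝓝 x, eval (f u) P = 0 := Iff.rfl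

theorem hp_ideal_prime {E τ : Type*} [NormedAddCommGroup E] [NormedSpace ℂ E] (f : E → τ → ℂ)
    (x : E) (hf : ∀ i, AnalyticAt ℂ (fun u => f u i) x) : (hpIdeal f x).IsPrime where
  ne_top' := by
    rw [Ideal.ne_top_iff_one, hp_mem_ideal]
    simp [NeBot.ne]
  mem_or_mem' := by
    intro P Q h
    simp only [hp_mem_ideal, map_mul] at h ⊢
    exact hp_mul_zero (hp_analytic_eval hf P) (hp_analytic_eval hf Q) h

theorem hp_local {E : Type} [NormedAddCommGroup E] [NormedSpace ℂ E] {n : ℕ} (z : E)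
    (x F : Fin n → E → ℂ) (D : Fin n → Fin n → E → ℂ) (c : Fin n → ℂ) (e : Fin n → Fin n → ℂ)
    (hx : ∀ j, AnalyticAt ℂ (x j) z) (hF : ∀ j, AnalyticAt ℂ (F j) z)
    (hD : ∀ j p, AnalyticAt ℂ (D j p) z)
    (G : Fin n → MvPolynomial (Option (Fin n ⊕ Fin n)) ℂ)
    (h0 : ∀ k, ∀ᶠ u in 𝓝 z,
      eval (fun i => i.elim (F k u) (Sum.elim (fun j => x j u) c)) (G k) = 0)
    (h1 : ∀ k, ¬ ∀ᶠ u in 𝓝 z,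
      eval (fun i => i.elim (F k u) (Sum.elim (fun j => x j u) c)) (pderiv none (G k)) = 0)
    (h2 : ∀ k p, ∀ᶠ u in 𝓝 z,
      eval (fun i => i.elim (F k u) (Sum.elim (fun j => x j u) c)) (pderiv none (G k)) * D k p u
      + ∑ j, eval (fun i => i.elim (F k u) (Sum.elim (fun j => x j u) c))
          (pderiv (some (Sum.inr j)) (G k)) * e j p = 0)
    (y : Fin (n + 1) → E → ℂ) (hy : ∀ i, (∃ j, y i = F j) ∨ ∃ k p, y i = D k p) :
    ∃ W : MvPolynomial (Fin (n + 1)) ℂ, W ≠ 0 ∧ ∀ᶠ u in 𝓝 z, eval (fun i => y i u) W = 0 := by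
  classical
  let f : E → (Fin n ⊕ (Fin n ⊕ (Fin n × Fin n))) → ℂ := fun u =>
    Sum.elim (fun j => x j u) (Sum.elim (fun j => F j u) fun q => D q.1 q.2 u)
  have hf : ∀ i, AnalyticAt ℂ (fun u => f u i) z := by
    rintro (j | j | ⟨j, p⟩)
    · exact hx j
    · exact hF j
    · exact hD j p
  have hprime := hp_ideal_prime f z hf
  let A := MvPolynomial (Fin n ⊕ (Fin n ⊕ (Fin n × Fin n))) ℂ ⧸ hpIdeal f z
  let π : MvPolynomial (Fin n ⊕ (Fin n ⊕ (Fin n × Fin n))) ℂ →ₐ[ℂ] A :=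
    Ideal.Quotient.mkₐ ℂ (hpIdeal f z)
  have hπ : ∀ P, π P = 0 ↔ ∀ᶠ u in 𝓝 z, eval (f u) P = 0 := by
    intro P
    rw [← hp_mem_ideal]
    exact Ideal.Quotient.eq_zero_iff_mem
  let xs : Fin n → A := fun j => π (X (Sum.inl j))
  let S := Algebra.adjoin ℂ (Set.range xs)
  let g : Fin n ⊕ Fin n → S := Sum.elim
    (fun j => ⟨xs j, Algebra.subset_adjoin ⟨j, rfl⟩⟩) (fun j => algebraMap ℂ S (c j))
  let sb : Fin n → Option (Fin n ⊕ Fin n) → MvPolynomial (Fin n ⊕ (Fin n ⊕ (Fin n × Fin n))) ℂ :=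
    fun k i => i.elim (X (Sum.inr (Sum.inl k))) (Sum.elim (fun j => X (Sum.inl j)) fun j => C (c j))
  have hsb : ∀ (k : Fin n) (H : MvPolynomial (Option (Fin n ⊕ Fin n)) ℂ), π (aeval (sb k) H) = aeval (fun i : Option (Fin n ⊕ Fin n) =>
      i.elim (π (X (Sum.inr (Sum.inl k)))) fun s => algebraMap S A (g s)) H := by
    intro k H
    rw [MvPolynomial.comp_aeval_apply]
    congr 2
    funext i
    rcases i with _ | j | j
    · rfl
    · rfl
    · simp only [sb, g, Option.elim, Sum.elim_inr]
      rw [← IsScalarTower.algebraMap_apply ℂ S A, ← MvPolynomial.algebraMap_eq]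
      exact AlgHom.commutes π _
  have hev : ∀ (k : Fin n) (H : MvPolynomial (Option (Fin n ⊕ Fin n)) ℂ) u, eval (f u) (aeval (sb k) H) =
      eval (fun i => i.elim (F k u) (Sum.elim (fun j => x j u) c)) H := by
    intro k H u
    have := MvPolynomial.comp_aeval_apply (sb k) (aeval (R := ℂ) (f u)) H
    simp only [MvPolynomial.aeval_eq_eval] at this
    rw [this]
    congr 2
    funext i
    rcases i with _ | j | j <;> simp [sb, f]
  have algF : ∀ k, IsAlgebraic S (π (X (Sum.inr (Sum.inl k)))) := by
    intro k
    refine hp_isAlgebraic g _ (G k) ?_ ?_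
    · rw [← hsb, hπ]
      simp_rw [hev]
      exact h0 k
    · rw [← hsb, Ne, hπ]
      simp_rw [hev]
      exact h1 k
  have algH : ∀ (k : Fin n) (H : MvPolynomial (Option (Fin n ⊕ Fin n)) ℂ), IsAlgebraic S (π (aeval (sb k) H)) := by
    intro k H
    rw [hsb]
    apply hp_alg_aeval
    rintro (_ | s)
    · exact algF k
    · exact isAlgebraic_algebraMap _
  have algD : ∀ k p, IsAlgebraic S (π (X (Sum.inr (Sum.inr (k, p))))) := by
    intro k p
    have hne : π (aeval (sb k) (pderiv none (G k))) ≠ 0 := by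
      rw [Ne, hπ]
      simp_rw [hev]
      exact h1 k
    refine IsAlgebraic.of_mul (mem_nonZeroDivisors_of_ne_zero hne) (algH _ _) ?_
    have hrel : π (aeval (sb k) (pderiv none (G k))) * π (X (Sum.inr (Sum.inr (k, p)))) =
        - π (aeval (sb k) (∑ j, pderiv (some (Sum.inr j)) (G k) * C (e j p))) := by
      rw [← sub_eq_zero, sub_neg_eq_add, ← map_mul, ← map_add, hπ]
      filter_upwards [h2 k p] with u hu
      rw [map_add, map_mul, hev, hev]
      simpa [f] using hu
    rw [hrel]
    exact (algH _ _).neg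
  let t : Fin (n + 1) → (Fin n ⊕ (Fin n ⊕ (Fin n × Fin n))) := fun i =>
    if h : ∃ j, y i = F j then Sum.inr (Sum.inl h.choose)
    else Sum.inr (Sum.inr (((hy i).resolve_left h).choose,
      ((hy i).resolve_left h).choose_spec.choose))
  have ht : ∀ i u, f u (t i) = y i u := by
    intro i u
    by_cases h : ∃ j, y i = F j
    · simp only [t, h, dite_true, f, Sum.elim_inr, Sum.elim_inl]
      exact (congrFun h.choose_spec u).symm
    · simp only [t, h, dite_false, f, Sum.elim_inr]
      exact (congrFun ((hy i).resolve_left h).choose_spec.choose_spec u).symm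
  have hta : ∀ i, IsAlgebraic S (π (X (t i))) := by
    intro i
    by_cases h : ∃ j, y i = F j
    · simp only [t, h, dite_true]
      exact algF _
    · simp only [t, h, dite_false]
      exact algD _ _
  have hdep := hp_dependent xs (fun i => π (X (t i))) hta
  rw [algebraicIndependent_iff] at hdep
  push Not at hdep
  obtain ⟨W, hW0, hW⟩ := hdep
  refine ⟨W, hW, ?_⟩
  have hW1 : π (aeval (fun i => X (t i)) W) = 0 := by
    rw [MvPolynomial.comp_aeval_apply]; exact hW0
  rw [hπ] at hW1
  filter_upwards [hW1] with u hu
  have := MvPolynomial.comp_aeval_apply (fun i => X (t i)) (aeval (R := ℂ) (f u)) W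
  simp only [aeval_eq_eval, eval_X, ht] at this
  rw [← this]
  exact hu

end Helpers
section Helpers2
open Filter Topology

theorem hp_pd_analytic {n : ℕ} {f : (Fin n → ℂ) → ℂ} {u : Fin n → ℂ} (p : Fin n)
    (hf : AnalyticAt ℂ f u) : AnalyticAt ℂ (pd f p) u :=
  ((ContinuousLinearMap.apply ℂ ℂ (Pi.single p (1 : ℂ) : Fin n → ℂ)).analyticAt _).comp hf.fderiv

theorem hp_entire {n : ℕ} {h : (Fin n → ℂ) → ℂ} (ha : ∀ u, AnalyticAt ℂ h u)
    (hne : ∃ u, h u ≠ 0) (w : Fin n → ℂ) : ¬ ∀ᶠ u in 𝓝 w, h u = 0 := by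
  intro hw
  obtain ⟨u, hu⟩ := hne
  have h1 : AnalyticOnNhd ℂ h Set.univ := fun u _ => ha u
  exact hu (h1.eqOn_zero_of_preconnected_of_eventuallyEq_zero isPreconnected_univ
    (Set.mem_univ w) hw (Set.mem_univ u))

theorem hp_entire_mul {n : ℕ} {h k : (Fin n → ℂ) → ℂ} (ha : ∀ u, AnalyticAt ℂ h u)
    (hne : ∃ u, h u ≠ 0) (ka : ∀ u, AnalyticAt ℂ k u)
    (kne : ∃ u, k u ≠ 0) : ∃ u, h u * k u ≠ 0 := by
  by_contra H
  push Not at H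
  rcases hp_mul_zero (ha 0) (ka 0) (Eventually.of_forall H) with h1 | h1
  · exact hp_entire ha hne 0 h1
  · exact hp_entire ka kne 0 h1

theorem hp_mero_const {n : ℕ} (a : ℂ) : Mero (fun _ : Fin n → ℂ => a) :=
  ⟨fun _ => a, fun _ => 1, fun _ => analyticAt_const, fun _ => analyticAt_const,
    ⟨0, one_ne_zero⟩, fun _ _ => by simp⟩

theorem hp_mero_add {n : ℕ} {f f' : (Fin n → ℂ) → ℂ} (h : Mero f) (h' : Mero f') :
    Mero (fun u => f u + f' u) := by
  obtain ⟨g, k, hg, hk, hne, e⟩ := h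
  obtain ⟨g', k', hg', hk', hne', e'⟩ := h'
  refine ⟨fun u => g u * k' u + k u * g' u, fun u => k u * k' u,
    fun u => ((hg u).fun_mul (hk' u)).fun_add ((hk u).fun_mul (hg' u)),
    fun u => (hk u).fun_mul (hk' u), hp_entire_mul hk hne hk' hne', fun u hu => ?_⟩
  have h1 := left_ne_zero_of_mul hu
  have h2 := right_ne_zero_of_mul hu
  show f u + f' u = _
  rw [e u h1, e' u h2, div_add_div _ _ h1 h2]

theorem hp_mero_mul {n : ℕ} {f f' : (Fin n → ℂ) → ℂ} (h : Mero f) (h' : Mero f') :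
    Mero (fun u => f u * f' u) := by
  obtain ⟨g, k, hg, hk, hne, e⟩ := h
  obtain ⟨g', k', hg', hk', hne', e'⟩ := h'
  refine ⟨fun u => g u * g' u, fun u => k u * k' u,
    fun u => (hg u).fun_mul (hg' u),
    fun u => (hk u).fun_mul (hk' u), hp_entire_mul hk hne hk' hne', fun u hu => ?_⟩
  show f u * f' u = _
  rw [e u (left_ne_zero_of_mul hu), e' u (right_ne_zero_of_mul hu), div_mul_div_comm]

theorem hp_mero_analytic {n : ℕ} {f g k : (Fin n → ℂ) → ℂ} (hg : ∀ u, AnalyticAt ℂ g u)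
    (hk : ∀ u, AnalyticAt ℂ k u) (e : ∀ u, k u ≠ 0 → f u = g u / k u) {u : Fin n → ℂ}
    (hu : k u ≠ 0) : AnalyticAt ℂ f u := by
  refine ((hg u).fun_div (hk u) hu).congr ?_
  filter_upwards [(hk u).continuousAt.eventually_ne hu] with w hw using (e w hw).symm

theorem hp_mero_pd {n : ℕ} {f : (Fin n → ℂ) → ℂ} (h : Mero f) (p : Fin n) : Mero (pd f p) := by
  obtain ⟨g, k, hg, hk, hne, e⟩ := h
  refine ⟨fun u => k u * pd g p u - g u * pd k p u, fun u => k u * k u,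
    fun u => ((hk u).fun_mul (hp_pd_analytic p (hg u))).fun_sub
      ((hg u).fun_mul (hp_pd_analytic p (hk u))),
    fun u => (hk u).fun_mul (hk u), hp_entire_mul hk hne hk hne, fun u hu => ?_⟩
  have h1 := left_ne_zero_of_mul hu
  have hf := hp_mero_analytic hg hk e h1
  have h2 : g =ᶠ[𝓝 u] fun w => f w * k w := by
    filter_upwards [(hk u).continuousAt.eventually_ne h1] with w hw
    rw [e w hw, div_mul_cancel₀ _ hw]
  have h3 := hf.differentiableAt.hasFDerivAt.fun_mul (hk u).differentiableAt.hasFDerivAt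
  have h4 : pd g p u = f u * pd k p u + k u * pd f p u := by
    unfold pd
    rw [h2.fderiv_eq, h3.fderiv]
    simp
  show pd f p u = (k u * pd g p u - g u * pd k p u) / (k u * k u)
  rw [h4, h2.self_of_nhds]
  field_simp
  ring

theorem hp_mero_eval {n : ℕ} {σ : Type*} {ψ : σ → (Fin n → ℂ) → ℂ} (h : ∀ i, Mero (ψ i))
    (W : MvPolynomial σ ℂ) : Mero (fun u => eval (fun i => ψ i u) W) := by
  induction W using MvPolynomial.induction_on with
  | C a => simpa using hp_mero_const a
  | add p q hp hq => simpa using hp_mero_add hp hq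
  | mul_X p i hp => simpa using hp_mero_mul hp (h i)

theorem hp_mero_zero {n : ℕ} {f : (Fin n → ℂ) → ℂ} (h : Mero f) {w : Fin n → ℂ}
    (hw : ∀ᶠ u in 𝓝 w, f u = 0) {u : Fin n → ℂ} (hu : ContinuousAt f u) : f u = 0 := by
  obtain ⟨g, k, hg, hk, hne, e⟩ := h
  have h1 : ∀ᶠ u in 𝓝 w, g u * k u = 0 := by
    filter_upwards [hw] with u hu
    by_cases hk0 : k u = 0
    · simp [hk0]
    · rw [e u hk0, div_eq_zero_iff] at hu
      simp [hu.resolve_right hk0]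
  have h2 : ∀ u, g u = 0 := by
    rcases hp_mul_zero (hg w) (hk w) h1 with h2 | h2
    · by_contra H
      push Not at H
      exact hp_entire hg H w h2
    · exact absurd h2 (hp_entire hk hne w)
  by_contra hfu
  refine hp_entire hk hne u ?_
  filter_upwards [hu.eventually_ne hfu] with v hv
  by_contra hkv
  exact hv (by rw [e v hkv, h2]; simp)

theorem hp_map_nhds {n : ℕ} (φ : Fin n → (Fin n → ℂ) → ℂ) (u : Fin n → ℂ)
    (hφ : ∀ j, AnalyticAt ℂ (φ j) u)
    (hdet : Matrix.det (Matrix.of fun k p => pd (φ k) p u) ≠ 0) :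
    map (fun w j => φ j w) (𝓝 u) = 𝓝 (fun j => φ j u) := by
  have hs : HasStrictFDerivAt (fun w j => φ j w)
      (ContinuousLinearMap.pi fun j => fderiv ℂ (φ j) u) u :=
    hasStrictFDerivAt_pi.2 fun j => (hφ j).hasStrictFDerivAt
  refine hs.map_nhds_eq_of_surj ?_
  rw [LinearMap.range_eq_top]
  intro b
  set M := Matrix.of fun k p => pd (φ k) p u with hM
  refine ⟨Matrix.mulVec M⁻¹ b, ?_⟩
  have key : ∀ v : Fin n → ℂ, (ContinuousLinearMap.pi fun j => fderiv ℂ (φ j) u) v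
      = Matrix.mulVec M v := by
    intro v
    funext j
    simp only [ContinuousLinearMap.pi_apply, Matrix.mulVec, dotProduct]
    conv_lhs => rw [pi_eq_sum_univ' v]
    rw [map_sum]
    refine Finset.sum_congr rfl fun p _ => ?_
    rw [map_smul, smul_eq_mul, mul_comm]
    congr 2
  refine (key _).trans ?_
  rw [Matrix.mulVec_mulVec, Matrix.mul_nonsing_inv _ (isUnit_iff_ne_zero.2 hdet), Matrix.one_mulVec]

theorem hp_poly_zero {σ : Type*} [Finite σ] (P : MvPolynomial σ ℂ) (a : σ → ℂ)
    (h : ∀ᶠ x in 𝓝 a, eval x P = 0) : P = 0 := by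
  cases nonempty_fintype σ
  obtain ⟨r, hr, hB⟩ := Metric.eventually_nhds_iff_ball.1 h
  refine MvPolynomial.funext_set (fun i => Metric.ball (a i) r) (fun i => ?_) fun x hx => ?_
  · exact infinite_of_mem_nhds (a i) (Metric.ball_mem_nhds _ hr)
  · rw [map_zero]
    apply hB
    rw [ball_pi _ hr]
    exact hx

theorem hp_indep {n : ℕ} (φ : Fin n → (Fin n → ℂ) → ℂ) (u v : Fin n → ℂ)
    (hu : map (fun w j => φ j w) (𝓝 u) = 𝓝 (fun j => φ j u))
    (hv : map (fun w j => φ j w) (𝓝 v) = 𝓝 (fun j => φ j v))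
    (P : MvPolynomial (Fin n ⊕ Fin n) ℂ)
    (h : ∀ᶠ q in 𝓝 (u, v), eval (Sum.elim (fun j => φ j q.1) fun j => φ j q.2) P = 0) :
    P = 0 := by
  refine hp_poly_zero P (Sum.elim (fun j => φ j u) fun j => φ j v) ?_
  have h1 : ∀ᶠ q in map (fun w j => φ j w) (𝓝 u) ×ˢ map (fun w j => φ j w) (𝓝 v),
      eval (Sum.elim q.1 q.2) P = 0 := by
    rw [Filter.prod_map_map_eq, eventually_map, ← nhds_prod_eq]
    exact h
  rw [hu, hv, ← nhds_prod_eq] at h1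
  have hc : Continuous (fun x : Fin n ⊕ Fin n → ℂ => (fun j => x (Sum.inl j), fun j => x (Sum.inr j)))
    := by fun_prop
  have h2 := (hc.tendsto (Sum.elim (fun j => φ j u) fun j => φ j v)).eventually h1
  filter_upwards [h2] with x hx
  rw [← hx]
  congr 2
  funext i
  cases i <;> rfl

theorem hp_minimal {n : ℕ} (φ : Fin n → (Fin n → ℂ) → ℂ) (u v : Fin n → ℂ)
    (hu : map (fun w j => φ j w) (𝓝 u) = 𝓝 (fun j => φ j u))
    (hv : map (fun w j => φ j w) (𝓝 v) = 𝓝 (fun j => φ j v)) (k : Fin n) (d : ℕ) :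
    ∀ G : MvPolynomial (Option (Fin n ⊕ Fin n)) ℂ, G.degreeOf none = d → G ≠ 0 →
    (∀ᶠ q in 𝓝 (u, v), eval (fun i => i.elim (φ k (q.1 + q.2))
      (Sum.elim (fun j => φ j q.1) fun j => φ j q.2)) G = 0) →
    ∃ G : MvPolynomial (Option (Fin n ⊕ Fin n)) ℂ, 
    (∀ᶠ q in 𝓝 (u, v), eval (fun i => i.elim (φ k (q.1 + q.2))
      (Sum.elim (fun j => φ j q.1) fun j => φ j q.2)) G = 0) ∧
    ¬ (∀ᶠ q in 𝓝 (u, v), eval (fun i => i.elim (φ k (q.1 + q.2))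
      (Sum.elim (fun j => φ j q.1) fun j => φ j q.2)) (pderiv none G) = 0) := by
  induction d using Nat.strong_induction_on with
  | _ d ih =>
  intro G hd hG hV
  by_cases hd0 : d = 0
  · exfalso
    have hvars : (none : Option (Fin n ⊕ Fin n)) ∉ G.vars := by
      rw [mem_vars_iff_degreeOf_ne_zero]; omega
    obtain ⟨P, rfl⟩ := exists_rename_eq_of_vars_subset_range G some (Option.some_injective _) (by
      intro i hi
      cases i with
      | none => exact absurd hi hvars
      | some s => exact ⟨s, rfl⟩)
    apply hG
    rw [hp_indep φ u v hu hv P, map_zero]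
    filter_upwards [hV] with q hq
    rw [eval_rename] at hq
    exact hq
  · obtain ⟨h1, h2⟩ := hp_degreeOf_pderiv none G (by omega)
    by_cases hV' : ∀ᶠ q in 𝓝 (u, v), eval (fun i => i.elim (φ k (q.1 + q.2))
      (Sum.elim (fun j => φ j q.1) fun j => φ j q.2)) (pderiv none G) = 0
    · exact ih _ (hd ▸ h2) _ rfl h1 hV'
    · exact ⟨G, hV, hV'⟩

end Helpers2

set_option maxHeartbeats 400000 in
theorem aat_any_n_plus_one_algebraically_dependent {n : ℕ} (hn : 1 ≤ n) (φ : Fin n → (Fin n → ℂ) → ℂ)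
    (hmero : ∀ k, Mero (φ k)) (hindep : AnalyticallyIndep φ) (haat : AdmitsAAT φ)
    (ψ : Fin (n + 1) → (Fin n → ℂ) → ℂ)
    (hψ : ∀ i, (∃ j, ψ i = φ j) ∨ ∃ k p, ψ i = pd (φ k) p) :
    ∃ W : MvPolynomial (Fin (n + 1)) ℂ, W ≠ 0 ∧
      ∀ u : Fin n → ℂ, (∀ j, AnalyticAt ℂ (φ j) u) →
        (∀ k p, AnalyticAt ℂ (pd (φ k) p) u) →
        eval (fun i => ψ i u) W = 0 := by
  classical
  choose g h hg hh hne he using hmero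
  obtain ⟨u0, hu0, hdet0⟩ := hindep
  have hanev : ∀ u, (∀ j, AnalyticAt ℂ (φ j) u) →
      ∀ᶠ w in nhds u, ∀ j, AnalyticAt ℂ (φ j) w := fun u hu =>
    Filter.eventually_all.2 fun j => (hu j).eventually_analyticAt
  have hdetev : ∀ᶠ v in nhds u0, Matrix.det (Matrix.of fun k p => pd (φ k) p v) ≠ 0 := by
    have hc : ContinuousAt (fun v => Matrix.det (Matrix.of fun k p => pd (φ k) p v)) u0 := by
      have hM : ContinuousAt (fun v => (Matrix.of fun k p => pd (φ k) p v)) u0 :=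
        continuousAt_pi.2 fun k => continuousAt_pi.2 fun p =>
          (hp_pd_analytic p (hu0 k)).continuousAt
      exact (Continuous.matrix_det continuous_id).continuousAt.comp hM
    exact hc.eventually_ne hdet0
  obtain ⟨v1, hprod, hv1, hdet1⟩ : ∃ v1, ∏ k, h k (u0 + v1) ≠ 0 ∧
      (∀ j, AnalyticAt ℂ (φ j) v1) ∧
      Matrix.det (Matrix.of fun k p => pd (φ k) p v1) ≠ 0 := by
    have h1 : ¬ ∀ᶠ v in nhds u0, ∏ k, h k (u0 + v) = 0 := by
      have ha : ∀ k u, AnalyticAt ℂ (fun v => h k (u0 + v)) u := fun k u =>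
        (hh k (u0 + u)).comp_of_eq (analyticAt_const.add analyticAt_id) rfl
      refine hp_prod_zero Finset.univ (fun k => ha k u0) fun k => hp_entire (ha k) ?_ u0
      obtain ⟨w, hw⟩ := hne k
      exact ⟨w - u0, by simpa using hw⟩
    rw [Filter.not_eventually] at h1
    exact (h1.and_eventually ((hanev u0 hu0).and hdetev)).exists
  have hs1 : ∀ k, AnalyticAt ℂ (φ k) (u0 + v1) := fun k =>
    hp_mero_analytic (hg k) (hh k) (he k) (Finset.prod_ne_zero_iff.1 hprod k (Finset.mem_univ k))
  have hgood : ∀ᶠ q in nhds (u0, v1), (∀ j, AnalyticAt ℂ (φ j) q.1) ∧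
      (∀ j, AnalyticAt ℂ (φ j) q.2) ∧ (∀ j, AnalyticAt ℂ (φ j) (q.1 + q.2)) := by
    have c1 : Continuous (fun q : (Fin n → ℂ) × (Fin n → ℂ) => q.1) := continuous_fst
    have c2 : Continuous (fun q : (Fin n → ℂ) × (Fin n → ℂ) => q.2) := continuous_snd
    have c3 : Continuous (fun q : (Fin n → ℂ) × (Fin n → ℂ) => q.1 + q.2) := by fun_prop
    exact ((c1.tendsto (u0, v1)).eventually (hanev _ hu0)).and
      (((c2.tendsto (u0, v1)).eventually (hanev _ hv1)).and
      ((c3.tendsto (u0, v1)).eventually (hanev _ hs1)))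
  have hmin : ∀ k, ∃ G : MvPolynomial (Option (Fin n ⊕ Fin n)) ℂ,
    (∀ᶠ q in nhds (u0, v1), eval (fun i => i.elim (φ k (q.1 + q.2))
      (Sum.elim (fun j => φ j q.1) fun j => φ j q.2)) G = 0) ∧
    ¬ (∀ᶠ q in nhds (u0, v1), eval (fun i => i.elim (φ k (q.1 + q.2))
      (Sum.elim (fun j => φ j q.1) fun j => φ j q.2)) (pderiv none G) = 0) := by
    intro k
    obtain ⟨G, hG1, hG2⟩ := haat k
    refine hp_minimal φ u0 v1 (hp_map_nhds φ u0 hu0 hdet0) (hp_map_nhds φ v1 hv1 hdet1) k _ G rfl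
      ?_ ?_
    · rintro rfl
      simp at hG1
    · filter_upwards [hgood] with q hq
      exact hG2 q.1 q.2 hq.1 hq.2.1 (hq.2.2 k)
  choose G hG hG' using hmin
  have hvan : ∀ k (q : (Fin n → ℂ) × (Fin n → ℂ)), (∀ j, AnalyticAt ℂ (φ j) q.1) →
      (∀ j, AnalyticAt ℂ (φ j) q.2) → (∀ j, AnalyticAt ℂ (φ j) (q.1 + q.2)) →
      ∀ i : Option (Fin n ⊕ Fin n), AnalyticAt ℂ
        (fun q : (Fin n → ℂ) × (Fin n → ℂ) => (i.elim (φ k (q.1 + q.2))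
      (Sum.elim (fun j => φ j q.1) fun j => φ j q.2) : ℂ)) q := by
    intro k q h1 h2 h3 i
    rcases i with _ | j | j
    · exact (h3 k).comp_of_eq (analyticAt_fst.add analyticAt_snd) rfl
    · exact (h1 j).comp_of_eq analyticAt_fst rfl
    · exact (h2 j).comp_of_eq analyticAt_snd rfl
  let vl : Fin n → (Fin n → ℂ) × (Fin n → ℂ) → Option (Fin n ⊕ Fin n) → ℂ :=
    fun k q i => i.elim (φ k (q.1 + q.2)) (Sum.elim (fun j => φ j q.1) fun j => φ j q.2)
  have hTa : ∀ k, AnalyticAt ℂ (fun q => eval (vl k q) (pderiv none (G k))) (u0, v1) :=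
    fun k => hp_analytic_eval (f := vl k) (x := (u0, v1)) (hvan k (u0, v1) hu0 hv1 hs1) _
  have hfreq : ¬ ∀ᶠ q in nhds (u0, v1), ∏ k, eval (vl k q) (pderiv none (G k)) = 0 :=
    hp_prod_zero (Finset.univ : Finset (Fin n)) hTa hG'
  rw [Filter.not_eventually] at hfreq
  have hGG := Filter.eventually_all.2 fun k => (hG k).eventually_nhds
  obtain ⟨⟨u2, v0⟩, hnz, ⟨hu2, hv0, hs2⟩, hq⟩ :=
    (hfreq.and_eventually (hgood.and hGG)).exists
  simp only at hnz hu2 hv0 hs2 hq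
  have hnz' := fun k => Finset.prod_ne_zero_iff.1 hnz k (Finset.mem_univ k)
  have hcu : Continuous (fun u : Fin n → ℂ => (u, v0)) := by fun_prop
  have hca : Continuous (fun u : Fin n → ℂ => u + v0) := by fun_prop
  have htr : ∀ f : (Fin n → ℂ) → ℂ, AnalyticAt ℂ f (u2 + v0) →
      AnalyticAt ℂ (fun u => f (u + v0)) u2 := fun f hf =>
    hf.comp_of_eq (analyticAt_id.add analyticAt_const) rfl
  have hVline : ∀ k, ∀ᶠ u in nhds u2, ∀ᶠ q in nhds (u, v0), eval (fun i => i.elim (φ k (q.1 + q.2))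
      (Sum.elim (fun j => φ j q.1) fun j => φ j q.2)) (G k) = 0 := fun k =>
    (hcu.tendsto u2).eventually (hq k).eventually_nhds
  obtain ⟨W, hW, hW0⟩ := hp_local u2 φ (fun k u => φ k (u + v0)) (fun k p u => pd (φ k) p (u + v0))
    (fun j => φ j v0) (fun j p => pd (φ j) p v0) hu2 (fun k => htr _ (hs2 k))
    (fun k p => htr _ (hp_pd_analytic p (hs2 k))) G
    (fun k => by
      filter_upwards [hVline k] with u hu
      exact hu.self_of_nhds)
    (fun k hc => hnz' k hc.self_of_nhds)
    (fun k p => by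
      filter_upwards [hVline k, (hca.tendsto u2).eventually (hs2 k).eventually_analyticAt]
        with u hu hua
      let γ : ℂ → (Fin n → ℂ) := fun t => v0 + t • (Pi.single p 1 : Fin n → ℂ)
      have hγ0 : γ 0 = v0 := by simp [γ]
      have hγ : HasDerivAt γ (Pi.single p 1 : Fin n → ℂ) 0 := by
        have h9 := ((hasDerivAt_id (0 : ℂ)).smul_const (Pi.single p 1 : Fin n → ℂ)).const_add v0
        rw [one_smul] at h9
        exact h9
      have hd := hp_hasDerivAt_eval (G k) (t := 0)
        (f := fun t i => i.elim (φ k (u + γ t)) (Sum.elim (fun j => φ j u) fun j => φ j (γ t)))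
        (f' := fun i => i.elim (pd (φ k) p (u + v0)) (Sum.elim (fun _ => 0) fun j => pd (φ j) p v0))
        (by
          rintro (_ | j | j)
          · exact HasFDerivAt.comp_hasDerivAt_of_eq (0 : ℂ)
              hua.differentiableAt.hasFDerivAt (hγ.const_add u) (by rw [hγ0])
          · exact hasDerivAt_const _ _
          · exact HasFDerivAt.comp_hasDerivAt_of_eq (0 : ℂ)
              (hv0 j).differentiableAt.hasFDerivAt hγ hγ0.symm)
      have hz : (fun t => eval (fun i : Option (Fin n ⊕ Fin n) => i.elim (φ k (u + γ t))
          (Sum.elim (fun j => φ j u) fun j => φ j (γ t))) (G k)) =ᶠ[nhds 0] fun _ => (0 : ℂ) := by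
        have hcc : Filter.Tendsto (fun t => (u, γ t)) (nhds 0) (nhds (u, v0)) := by
          have := (continuousAt_const (y := u)).prodMk hγ.continuousAt
          rw [ContinuousAt, hγ0] at this
          exact this
        exact hcc.eventually hu
      have h0 := (hd.congr_of_eventuallyEq hz.symm).unique (hasDerivAt_const (0 : ℂ) (0 : ℂ))
      rw [hγ0] at h0
      simpa [Fintype.sum_option, Fintype.sum_sum_type] using h0)
    (fun i u => ψ i (u + v0))
    (by
      intro i
      rcases hψ i with ⟨j, hj⟩ | ⟨k, p, hj⟩
      · exact Or.inl ⟨j, by rw [hj]⟩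
      · exact Or.inr ⟨k, p, by rw [hj]⟩)
  refine ⟨W, hW, fun u hua hub => ?_⟩
  have hψm : ∀ i, Mero (ψ i) := by
    intro i
    have hm : ∀ k, Mero (φ k) := fun k => ⟨g k, h k, hg k, hh k, hne k, he k⟩
    rcases hψ i with ⟨j, hj⟩ | ⟨k, p, hj⟩
    · rw [hj]; exact hm j
    · rw [hj]; exact hp_mero_pd (hm k) p
  have hψa : ∀ i, AnalyticAt ℂ (ψ i) u := by
    intro i
    rcases hψ i with ⟨j, hj⟩ | ⟨k, p, hj⟩
    · rw [hj]; exact hua j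
    · rw [hj]; exact hub k p
  refine hp_mero_zero (hp_mero_eval hψm W) (w := u2 + v0) ?_
    (hp_analytic_eval (f := fun u i => ψ i u) hψa W).continuousAt
  have hcs : Continuous (fun w : Fin n → ℂ => w - v0) := by fun_prop
  have ht := hcs.tendsto (u2 + v0)
  rw [add_sub_cancel_right] at ht
  filter_upwards [ht.eventually hW0] with w hw
  simpa using hw
end

section
/- Suppose the meromorphic mapping Φ = (φ₁,…,φ_n) admits an algebraic addition theorem. Then for each k ∈ {1,…,n} the function φ_k is algebraically dependent on its n first-order partial derivatives: there exists a nonzero polynomial W ∈ ℂ[t₀, t₁,…,t_n] such that W(φ_k(u); ∂φ_k/∂u₁(u),…,∂φ_k/∂u_n(u)) = 0 for every u at which φ₁,…,φ_n and their first-order partial derivatives are analytic. -/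
open MvPolynomial

lemma hasDerivAt_eval {σ : Type*} [Fintype σ] (c : ℂ → σ → ℂ) (c' : σ → ℂ) (t0 : ℂ)
    (h : ∀ i, HasDerivAt (fun t => c t i) (c' i) t0) (G : MvPolynomial σ ℂ) :
    HasDerivAt (fun t => eval (c t) G) (∑ i, eval (c t0) (pderiv i G) * c' i) t0 := by
  classical
  induction G using MvPolynomial.induction_on with
  | C a => simpa using hasDerivAt_const t0 a
  | add p q hp hq =>
    simp only [map_add, add_mul, Finset.sum_add_distrib]
    exact hp.add hq
  | mul_X p i hp =>
    have := hp.mul (h i)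
    simp only [map_mul, eval_X]
    refine HasDerivAt.congr_deriv (f := fun t => eval (c t) p * c t i) this ?_
    simp only [pderiv_mul, map_add, map_mul, eval_X, pderiv_X, add_mul, Finset.sum_add_distrib,
      Finset.sum_mul]
    congr 1
    · exact Finset.sum_congr rfl fun j _ => by ring
    · rw [Finset.sum_eq_single i]
      · simp
      · intro j _ hj; simp [hj.symm]
      · simp

lemma degreeOf_pderiv_lt {σ : Type*} (i : σ) (G : MvPolynomial σ ℂ) (h : pderiv i G ≠ 0) :
    (pderiv i G).degreeOf i < G.degreeOf i := by
  classical
  have key : ∀ m ∈ (pderiv i G).support, m i + 1 ≤ G.degreeOf i := by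
    intro m hm
    rw [mem_support_iff, coeff_pderiv] at hm
    have : m + Finsupp.single i 1 ∈ G.support := by
      rw [mem_support_iff]; intro h0; simp [h0] at hm
    have := monomial_le_degreeOf i this
    simpa using this
  obtain ⟨m0, hm0⟩ := support_nonempty.2 h
  rw [degreeOf_lt_iff (by have := key m0 hm0; omega)]
  intro m hm
  exact key m hm

lemma degreeOf_eq_zero_of_pderiv {σ : Type*} (i : σ) (G : MvPolynomial σ ℂ)
    (h : pderiv i G = 0) : i ∉ G.vars := by
  classical
  intro hi
  obtain ⟨m, hm, hmi⟩ := (mem_vars_iff_mem_support i).1 hi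
  have hmi : m i ≠ 0 := by simpa using hmi
  have h1 := coeff_pderiv (i := i) G (m - Finsupp.single i 1)
  have h2 : m - Finsupp.single i 1 + Finsupp.single i 1 = m := by
    apply tsub_add_cancel_of_le
    simpa using Nat.one_le_iff_ne_zero.2 hmi
  rw [h, h2, coeff_zero] at h1
  rw [mem_support_iff] at hm
  have : (((m - Finsupp.single i 1 : σ →₀ ℕ) i : ℕ) : ℂ) + 1 ≠ 0 := by exact Nat.cast_add_one_ne_zero _
  exact (mul_ne_zero hm this) h1.symm

lemma alg_dep {n : ℕ} {A : Type*} [CommRing A] [IsDomain A] [Algebra ℂ A] (x : Fin n → A)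
    (c : Option (Fin n) → A) (hc : ∀ i, IsAlgebraic (Algebra.adjoin ℂ (Set.range x)) (c i)) :
    ∃ W : MvPolynomial (Option (Fin n)) ℂ, W ≠ 0 ∧ aeval c W = 0 := by
  classical
  by_contra hcon
  push Not at hcon
  have hind : AlgebraicIndependent ℂ c := by
    rw [algebraicIndependent_iff]
    intro p hp
    by_contra h
    exact hcon p h hp
  have hs : (AlgebraicIndependent.matroid ℂ A).Indep (Set.range c) := by
    rw [AlgebraicIndependent.matroid_indep_iff]
    exact AlgebraicIndependent.to_subtype_range hind
  have hsub : Set.range c ⊆ (AlgebraicIndependent.matroid ℂ A).closure (Set.range x) := by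
    rw [AlgebraicIndependent.matroid_closure_eq]
    rintro _ ⟨i, rfl⟩
    exact hc i
  have h1 : (Set.range c).encard ≤ (Set.range x).encard := by
    rw [← hs.eRk_eq_encard]
    refine (Matroid.eRk_mono _ hsub).trans ?_
    rw [Matroid.eRk_closure_eq]
    exact Matroid.eRk_le_encard _ _
  rw [← Set.image_univ, hind.injective.encard_image, ← Set.image_univ] at h1
  have := h1.trans (Set.encard_image_le _ _)
  simp at this
  have h3 : n + 1 ≤ n := by exact_mod_cast this
  omega

lemma derivative_aeval {σ : Type*} [DecidableEq σ] {B : Type*} [CommRing B] [Algebra ℂ B]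
    (i : σ) (f : σ → Polynomial B) (hf : f i = Polynomial.X)
    (hf' : ∀ j, j ≠ i → Polynomial.derivative (f j) = 0) (G : MvPolynomial σ ℂ) :
    Polynomial.derivative (aeval f G) = aeval f (pderiv i G) := by
  induction G using MvPolynomial.induction_on with
  | C a =>
    simp only [pderiv_C, map_zero, aeval_C]
    rw [IsScalarTower.algebraMap_apply ℂ B (Polynomial B), Polynomial.algebraMap_eq]
    simp
  | add p q hp hq => simp [hp, hq]
  | mul_X p j hp =>
    rw [map_mul, Polynomial.derivative_mul, hp, aeval_X, pderiv_mul, map_add, map_mul, map_mul,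
      aeval_X]
    congr 1
    by_cases h : j = i
    · subst h; simp [hf]
    · simp [hf' j h, pderiv_X_of_ne h]

lemma algebra_main {n : ℕ} {A : Type*} [CommRing A] [IsDomain A] [Algebra ℂ A] (x : Fin n → A)
    (y : Fin n → ℂ) (z : A) (w : Fin n → A) (e : Option (Fin n ⊕ Fin n) → A)
    (he : e = fun i => i.elim z (Sum.elim x (fun j => algebraMap ℂ A (y j))))
    (G : MvPolynomial (Option (Fin n ⊕ Fin n)) ℂ) (h0 : aeval e G = 0)
    (h1 : aeval e (pderiv none G) ≠ 0)
    (Q : Fin n → MvPolynomial (Option (Fin n ⊕ Fin n)) ℂ)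
    (h2 : ∀ p, aeval e (pderiv none G) * w p = aeval e (Q p)) :
    ∃ W : MvPolynomial (Option (Fin n)) ℂ, W ≠ 0 ∧
      aeval (fun i : Option (Fin n) => i.elim z w) W = 0 := by
  classical
  apply alg_dep x
  set B := Algebra.adjoin ℂ (Set.range x) with hB
  have hx : ∀ j, x j ∈ B := fun j => Algebra.subset_adjoin ⟨j, rfl⟩
  have hz : IsAlgebraic B z := by
    let f : Option (Fin n ⊕ Fin n) → Polynomial B := fun i => i.elim Polynomial.X
      (Sum.elim (fun j => Polynomial.C ⟨x j, hx j⟩)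
        (fun j => Polynomial.C (algebraMap ℂ B (y j))))
    have hev : ∀ R : MvPolynomial (Option (Fin n ⊕ Fin n)) ℂ, Polynomial.aeval z (aeval f R) = aeval e R := by
      intro R
      have h3 : (((Polynomial.aeval (R := B) z).restrictScalars ℂ).comp (aeval f)) = aeval e := by
        apply MvPolynomial.algHom_ext
        intro i
        subst he
        rcases i with _ | j | j
        · simp [f]
        · simp [f]
        · simp [f]
      exact DFunLike.congr_fun h3 R
    refine ⟨aeval f G, ?_, by rw [hev, h0]⟩
    intro hp
    apply h1
    rw [← hev, ← derivative_aeval none f rfl _ G, hp]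
    · simp
    · intro j hj
      rcases j with _ | j | j
      · exact absurd rfl hj
      · simp [f]
      · simp [f]
  let C := Subalgebra.algebraicClosure B A
  have heC : ∀ R : MvPolynomial (Option (Fin n ⊕ Fin n)) ℂ, aeval e R ∈ C := by
    have he' : ∀ i, e i ∈ C := by
      intro i
      subst he
      rcases i with _ | j | j
      · exact hz
      · exact isAlgebraic_algebraMap (⟨x j, hx j⟩ : B)
      · exact isAlgebraic_algebraMap (algebraMap ℂ B (y j))
    intro R
    have h3 : aeval e R ∈ Algebra.adjoin ℂ (Set.range e) := by
      rw [Algebra.adjoin_range_eq_range_aeval]; exact ⟨R, rfl⟩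
    have h4 : Algebra.adjoin ℂ (Set.range e) ≤ C.restrictScalars ℂ := by
      rw [Algebra.adjoin_le_iff]
      rintro _ ⟨i, rfl⟩
      exact he' i
    exact h4 h3
  intro i
  rcases i with _ | p
  · exact hz
  · change IsAlgebraic B (w p)
    have : IsAlgebraic C (w p) := by
      refine ⟨Polynomial.C ⟨_, heC (pderiv none G)⟩ * Polynomial.X
        - Polynomial.C ⟨_, heC (Q p)⟩, ?_, ?_⟩
      · intro h
        have := congrArg (fun q => Polynomial.coeff q 1) h
        simp [Polynomial.coeff_C] at this
        exact h1 (congrArg Subtype.val this)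
      · simp [h2 p]
    exact this.restrictScalars B

open Filter Topology

lemma dense_ne_zero {n : ℕ} (h : (Fin n → ℂ) → ℂ) (ha : ∀ u, AnalyticAt ℂ h u)
    (hne : ∃ u, h u ≠ 0) : Dense {u | h u ≠ 0} := by
  by_contra hd
  rw [Dense] at hd
  push Not at hd
  obtain ⟨u, hu⟩ := hd
  rw [mem_closure_iff_frequently, not_frequently] at hu
  obtain ⟨w, hw⟩ := hne
  have : AnalyticOnNhd ℂ h Set.univ := fun x _ => ha x
  have h0 := this.eqOn_zero_of_preconnected_of_eventuallyEq_zero isPreconnected_univ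
    (Set.mem_univ u) (hu.mono fun x hx => by simpa using hx)
  exact hw (h0 (Set.mem_univ w))

lemma zero_of_dense {n : ℕ} {D : Set (Fin n → ℂ)} (hD : Dense D) (f : (Fin n → ℂ) → ℂ)
    (u : Fin n → ℂ) (hf : ContinuousAt f u) (h : ∀ᶠ w in 𝓝 u, w ∈ D → f w = 0) : f u = 0 := by
  by_contra hne
  have h1 := (hf.eventually_ne hne).and h
  obtain ⟨w, hw, hw'⟩ := hD.inter_nhds_nonempty h1
  exact hw'.1 (hw'.2 hw)

lemma mero_analyticAt {n : ℕ} {f g h : (Fin n → ℂ) → ℂ} (hh : ∀ u, AnalyticAt ℂ h u) (hf : ∀ u, h u ≠ 0 → f u = g u / h u) (u : Fin n → ℂ)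
    (hu : h u ≠ 0) : f =ᶠ[𝓝 u] (fun u => g u / h u) :=
  ((hh u).continuousAt.eventually_ne hu).mono fun w hw => hf w hw

/-- Algebra of functions on `U` that are restrictions of analytic functions. -/
def anSub {n : ℕ} (U : Set (Fin n → ℂ)) : Subalgebra ℂ (U → ℂ) where
  carrier := {f | ∃ g : (Fin n → ℂ) → ℂ, AnalyticOnNhd ℂ g U ∧ ∀ x : U, f x = g x}
  mul_mem' := by
    rintro a b ⟨g, hg, hag⟩ ⟨g', hg', hbg⟩
    exact ⟨g * g', hg.mul hg', fun x => by simp [hag, hbg]⟩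
  add_mem' := by
    rintro a b ⟨g, hg, hag⟩ ⟨g', hg', hbg⟩
    exact ⟨g + g', hg.add hg', fun x => by simp [hag, hbg]⟩
  algebraMap_mem' := by
    intro r
    exact ⟨fun _ => r, analyticOnNhd_const, fun x => rfl⟩

lemma anSub_isDomain {n : ℕ} (U : Set (Fin n → ℂ)) (hU : IsOpen U) (hc : IsPreconnected U)
    (hne : U.Nonempty) : IsDomain (anSub U) := by
  have : Nonempty U := hne.to_subtype
  have : Nontrivial (anSub U) := inferInstance
  have : NoZeroDivisors (anSub U) := by
    constructor
    rintro ⟨a, g, hg, hag⟩ ⟨b, g', hg', hbg⟩ hab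
    by_cases ha : a = 0
    · left; exact Subtype.ext ha
    · right
      apply Subtype.ext
      obtain ⟨w, hw⟩ := Function.ne_iff.1 ha
      have hgw : g w ≠ 0 := by rw [← hag]; exact hw
      have hz : g' =ᶠ[𝓝 (w : Fin n → ℂ)] 0 := by
        filter_upwards [(hg w w.2).continuousAt.eventually_ne hgw, hU.mem_nhds w.2] with y hy hyU
        have h1 := congrFun (congrArg Subtype.val hab) ⟨y, hyU⟩
        have h2 : a ⟨y, hyU⟩ * b ⟨y, hyU⟩ = 0 := h1
        rw [hag, hbg] at h2
        exact (mul_eq_zero.1 h2).resolve_left hy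
      funext y
      have := hg'.eqOn_zero_of_preconnected_of_eventuallyEq_zero hc w.2 hz y.2
      change b y = 0
      rw [hbg]; exact this
  exact NoZeroDivisors.to_isDomain _

lemma homog_eval {σ : Type*} [Fintype σ] (W : MvPolynomial σ ℂ) (num : σ → ℂ) (H : ℂ)
    (hH : H ≠ 0) :
    H ^ W.totalDegree * eval (fun i => num i / H) W =
      ∑ m ∈ W.support, coeff m W * (H ^ (W.totalDegree - ∑ i, m i) * ∏ i, num i ^ m i) := by
  rw [eval_eq', Finset.mul_sum]
  refine Finset.sum_congr rfl fun m hm => ?_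
  have hd : ∑ i, m i ≤ W.totalDegree := by
    have := le_totalDegree hm
    rwa [Finsupp.sum_fintype _ _ (fun _ => rfl)] at this
  have : ∏ i, (num i / H) ^ m i = (∏ i, num i ^ m i) / H ^ (∑ i, m i) := by
    rw [← Finset.prod_pow_eq_pow_sum, ← Finset.prod_div_distrib]
    exact Finset.prod_congr rfl fun i _ => div_pow _ _ _
  rw [this]
  have h2 : H ^ W.totalDegree = H ^ (W.totalDegree - ∑ i, m i) * H ^ (∑ i, m i) := by
    rw [← pow_add, Nat.sub_add_cancel hd]
  rw [h2]
  have := pow_ne_zero (∑ i, m i) hH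
  field_simp

lemma analyticAt_pd {n : ℕ} {f : (Fin n → ℂ) → ℂ} {u : Fin n → ℂ} (h : AnalyticAt ℂ f u)
    (p : Fin n) : AnalyticAt ℂ (pd f p) u :=
  ((ContinuousLinearMap.apply ℂ ℂ (Pi.single p 1 : Fin n → ℂ)).analyticAt _).fun_comp h.fderiv

lemma extend {n : ℕ} (f : (Fin n → ℂ) → ℂ) (hf : Mero f) (W : MvPolynomial (Option (Fin n)) ℂ)
    (O : Set (Fin n → ℂ)) (hO : IsOpen O) (hOne : O.Nonempty)
    (hW : ∀ u ∈ O, eval (fun i : Option (Fin n) => i.elim (f u) fun p => pd f p u) W = 0)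
    (u : Fin n → ℂ) (hu : AnalyticAt ℂ f u) :
    eval (fun i : Option (Fin n) => i.elim (f u) fun p => pd f p u) W = 0 := by
  obtain ⟨g, h, hg, hh, hne, hfg⟩ := hf
  have hD := dense_ne_zero h hh hne
  let num : (Fin n → ℂ) → Option (Fin n) → ℂ := fun u i =>
    i.elim (g u * h u) fun p => pd g p u * h u - g u * pd h p u
  have hval : ∀ u, h u ≠ 0 → (fun i : Option (Fin n) => i.elim (f u) fun p => pd f p u) =
      fun i => num u i / (h u ^ 2) := by
    intro u hu
    funext i
    rcases i with _ | p
    · change f u = g u * h u / h u ^ 2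
      rw [hfg u hu]; field_simp
    · change pd f p u = (pd g p u * h u - g u * pd h p u) / h u ^ 2
      unfold pd
      have hfa : DifferentiableAt ℂ f u :=
        (((hg u).div (hh u) hu).congr (mero_analyticAt hh hfg u hu).symm).differentiableAt
      have hmul : g =ᶠ[𝓝 u] fun w => f w * h w := by
        filter_upwards [(hh u).continuousAt.eventually_ne hu] with w hw
        rw [hfg w hw]; field_simp
      have hd : fderiv ℂ g u = f u • fderiv ℂ h u + h u • fderiv ℂ f u := by
        rw [hmul.fderiv_eq, fderiv_fun_mul hfa (hh u).differentiableAt]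
      rw [hd]
      simp only [_root_.add_apply, _root_.smul_apply, smul_eq_mul]
      rw [hfg u hu]
      field_simp
      ring
  let F : (Fin n → ℂ) → ℂ := fun u => ∑ m ∈ W.support, coeff m W *
    ((h u ^ 2) ^ (W.totalDegree - ∑ i, m i) * ∏ i, num u i ^ m i)
  have hnum : ∀ i u, AnalyticAt ℂ (fun u => num u i) u := by
    intro i u
    rcases i with _ | p
    · exact (hg u).mul (hh u)
    · exact ((analyticAt_pd (hg u) p).mul (hh u)).sub ((hg u).mul (analyticAt_pd (hh u) p))
  have hF : AnalyticOnNhd ℂ F Set.univ := by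
    intro u _
    refine Finset.analyticAt_fun_sum _ fun m _ => ?_
    refine analyticAt_const.mul ((((hh u).pow 2).pow _).mul ?_)
    exact Finset.analyticAt_fun_prod _ fun i _ => (hnum i u).pow _
  have hFW : ∀ u, h u ≠ 0 → (h u ^ 2) ^ W.totalDegree *
      eval (fun i : Option (Fin n) => i.elim (f u) fun p => pd f p u) W = F u := by
    intro u hu
    rw [hval u hu]
    exact homog_eval W (num u) _ (pow_ne_zero 2 hu)
  obtain ⟨a, haO, hah⟩ := hD.inter_open_nonempty O hO hOne
  have hF0 : ∀ u, F u = 0 := by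
    intro u
    refine hF.eqOn_zero_of_preconnected_of_eventuallyEq_zero isPreconnected_univ
      (Set.mem_univ a) ?_ (Set.mem_univ u)
    filter_upwards [hO.mem_nhds haO, (hh a).continuousAt.eventually_ne hah] with w hw hw'
    rw [← hFW w hw', hW w hw]; simp
  refine zero_of_dense hD
    (fun u => eval (fun i : Option (Fin n) => i.elim (f u) fun p => pd f p u) W) u ?_ ?_
  · refine (MvPolynomial.continuous_eval W).continuousAt.comp (continuousAt_pi.2 fun i => ?_)
    rcases i with _ | p
    · exact hu.continuousAt
    · exact (analyticAt_pd hu p).continuousAt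
  · refine Eventually.of_forall fun w hw => ?_
    have := hFW w hw
    rw [hF0 w] at this
    exact (mul_eq_zero.1 this).resolve_left (pow_ne_zero _ (pow_ne_zero _ hw))

/-- The relation of an addition theorem, for an arbitrary polynomial. -/
def AATRel {n : ℕ} (φ : Fin n → (Fin n → ℂ) → ℂ) (k : Fin n)
    (G : MvPolynomial (Option (Fin n ⊕ Fin n)) ℂ) : Prop :=
  ∀ u v : Fin n → ℂ, (∀ j, AnalyticAt ℂ (φ j) u) → (∀ j, AnalyticAt ℂ (φ j) v) →
      AnalyticAt ℂ (φ k) (u + v) →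
      eval (fun i => i.elim (φ k (u + v)) (Sum.elim (fun j => φ j u) fun j => φ j v)) G = 0

lemma eval_congr_none {n : ℕ} (G : MvPolynomial (Option (Fin n ⊕ Fin n)) ℂ)
    (hG : none ∉ G.vars) (e e' : Option (Fin n ⊕ Fin n) → ℂ)
    (h : ∀ i, e (some i) = e' (some i)) : eval e G = eval e' G := by
  refine eval₂Hom_congr' rfl ?_ rfl
  intro i hi _
  rcases i with _ | i
  · exact absurd hi hG
  · exact h i

lemma image_nhds {n : ℕ} (φ : Fin n → (Fin n → ℂ) → ℂ) (u : Fin n → ℂ)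
    (ha : ∀ j, AnalyticAt ℂ (φ j) u)
    (hdet : Matrix.det (Matrix.of fun k p => pd (φ k) p u) ≠ 0) :
    map (fun w j => φ j w) (𝓝 u) = 𝓝 (fun j => φ j u) := by
  have hs : HasStrictFDerivAt (fun w j => φ j w)
      (ContinuousLinearMap.pi fun j => fderiv ℂ (φ j) u) u :=
    hasStrictFDerivAt_pi.2 fun j => (ha j).hasStrictFDerivAt
  refine hs.map_nhds_eq_of_surj ?_
  rw [LinearMap.range_eq_top]
  intro y
  set M := Matrix.of fun k p => pd (φ k) p u with hM
  refine ⟨M⁻¹.mulVec y, ?_⟩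
  have key : ∀ v : Fin n → ℂ, (fun j => fderiv ℂ (φ j) u v) = M.mulVec v := by
    intro v
    funext j
    have := LinearMap.pi_apply_eq_sum_univ (fderiv ℂ (φ j) u : (Fin n → ℂ) →ₗ[ℂ] ℂ) v
    simp only [ContinuousLinearMap.coe_coe] at this
    rw [this, Matrix.mulVec, dotProduct]
    refine Finset.sum_congr rfl fun p _ => ?_
    simp only [hM, Matrix.of_apply, pd, smul_eq_mul]
    rw [mul_comm]
    congr 2
    funext q
    simp [Pi.single_apply, eq_comm]
  have h2 := key (M⁻¹.mulVec y)
  rw [Matrix.mulVec_mulVec, Matrix.mul_nonsing_inv _ (isUnit_iff_ne_zero.2 hdet),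
    Matrix.one_mulVec] at h2
  exact h2

lemma no_rel {n : ℕ} (φ : Fin n → (Fin n → ℂ) → ℂ) (k : Fin n)
    (hmero : ∀ k, Mero (φ k)) (hindep : AnalyticallyIndep φ)
    (G : MvPolynomial (Option (Fin n ⊕ Fin n)) ℂ) (hG : none ∉ G.vars) (hR : AATRel φ k G) :
    G = 0 := by
  obtain ⟨u0, ha, hdet⟩ := hindep
  obtain ⟨g, h, hg, hh, hne, hfg⟩ := hmero k
  have hD := dense_ne_zero h hh hne
  have hopen : ∀ v, (∀ j, AnalyticAt ℂ (φ j) v) → ∀ᶠ w in 𝓝 v, ∀ j, AnalyticAt ℂ (φ j) w :=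
    fun v hv => eventually_all.2 fun j => (isOpen_analyticAt ℂ (φ j)).mem_nhds (hv j)
  have h1 : ∀ u v, (∀ j, AnalyticAt ℂ (φ j) u) → (∀ j, AnalyticAt ℂ (φ j) v) →
      eval (fun i : Option (Fin n ⊕ Fin n) =>
        i.elim 0 (Sum.elim (fun j => φ j u) fun j => φ j v)) G = 0 := by
    intro u v hu hv
    have hD' : Dense {v | h (u + v) ≠ 0} := by
      refine dense_ne_zero (fun v => h (u + v)) (fun v => ?_) ?_
      · exact (hh (u + v)).fun_comp (analyticAt_const.add analyticAt_id)
      · obtain ⟨w, hw⟩ := hne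
        exact ⟨w - u, by simpa using hw⟩
    refine zero_of_dense hD' (fun v => eval (fun i : Option (Fin n ⊕ Fin n) =>
        i.elim 0 (Sum.elim (fun j => φ j u) fun j => φ j v)) G) v ?_ ?_
    · refine (MvPolynomial.continuous_eval G).continuousAt.comp (continuousAt_pi.2 fun i => ?_)
      rcases i with _ | j | j
      · exact continuousAt_const
      · exact continuousAt_const
      · exact (hv j).continuousAt
    · filter_upwards [hopen v hv] with w hw hw'
      rw [← hR u w hu hw ?_]
      · exact eval_congr_none G hG _ _ fun i => rfl
      · exact ((hg _).div (hh _) hw').congr (mero_analyticAt hh hfg _ hw').symm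
  have h2 : (fun w j => φ j w) '' {w | ∀ j, AnalyticAt ℂ (φ j) w} ∈ 𝓝 (fun j => φ j u0) := by
    rw [← image_nhds φ u0 ha hdet]
    exact image_mem_map (hopen u0 ha)
  obtain ⟨δ, hδ, hball⟩ := Metric.mem_nhds_iff.1 h2
  let s : Option (Fin n ⊕ Fin n) → Set ℂ := fun i => i.elim Set.univ
    (Sum.elim (fun j => Metric.ball (φ j u0) δ) (fun j => Metric.ball (φ j u0) δ))
  have hinf : ∀ c : ℂ, (Metric.ball c δ).Infinite := fun c =>
    infinite_of_mem_nhds c (Metric.ball_mem_nhds c hδ)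
  refine funext_set s ?_ ?_
  · intro i
    rcases i with _ | j | j
    · exact Set.infinite_univ
    · exact hinf _
    · exact hinf _
  · intro e he
    have hl : (fun j => e (some (Sum.inl j))) ∈ Metric.ball (fun j => φ j u0) δ := by
      rw [ball_pi _ hδ]; exact fun j _ => he (some (Sum.inl j)) trivial
    have hr : (fun j => e (some (Sum.inr j))) ∈ Metric.ball (fun j => φ j u0) δ := by
      rw [ball_pi _ hδ]; exact fun j _ => he (some (Sum.inr j)) trivial
    obtain ⟨u, hu, hue⟩ := hball hl
    obtain ⟨v, hv, hve⟩ := hball hr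
    rw [map_zero, ← h1 u v hu hv]
    refine eval_congr_none G hG _ _ ?_
    rintro (j | j)
    · exact (congrFun hue j).symm
    · exact (congrFun hve j).symm

theorem aat_function_algebraic_over_its_derivatives {n : ℕ} (hn : 1 ≤ n) (φ : Fin n → (Fin n → ℂ) → ℂ)
    (hmero : ∀ k, Mero (φ k)) (hindep : AnalyticallyIndep φ) (haat : AdmitsAAT φ)
    (k : Fin n) :
    ∃ W : MvPolynomial (Option (Fin n)) ℂ, W ≠ 0 ∧
      ∀ u : Fin n → ℂ, (∀ j, AnalyticAt ℂ (φ j) u) →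
        (∀ j p, AnalyticAt ℂ (pd (φ j) p) u) →
        eval (fun i => i.elim (φ k u) fun p => pd (φ k) p u) W = 0 := by
  classical
  -- a nonzero relation of minimal degree in `λ`
  have hex : ∃ d : ℕ, ∃ G : MvPolynomial (Option (Fin n ⊕ Fin n)) ℂ,
      G ≠ 0 ∧ AATRel φ k G ∧ G.degreeOf none = d := by
    obtain ⟨G, hd, hG⟩ := haat k
    refine ⟨_, G, ?_, hG, rfl⟩
    rintro rfl
    simp at hd
  obtain ⟨G, hG0, hGR, hGd⟩ := Nat.find_spec hex
  have hD0 : pderiv none G ≠ 0 := fun h =>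
    hG0 (no_rel φ k hmero hindep G (degreeOf_eq_zero_of_pderiv none G h) hGR)
  have hDR : ¬ AATRel φ k (pderiv none G) := fun h =>
    Nat.find_min hex (hGd ▸ degreeOf_pderiv_lt none G hD0) ⟨_, hD0, h, rfl⟩
  unfold AATRel at hDR
  push Not at hDR
  obtain ⟨u1, v1, hu1, hv1, huv1, hne⟩ := hDR
  have hopen : ∀ v, (∀ j, AnalyticAt ℂ (φ j) v) → ∀ᶠ w in 𝓝 v, ∀ j, AnalyticAt ℂ (φ j) w :=
    fun v hv => eventually_all.2 fun j => (isOpen_analyticAt ℂ (φ j)).mem_nhds (hv j)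
  have hk : ∀ᶠ u in 𝓝 u1, AnalyticAt ℂ (φ k) (u + v1) := by
    have hc : ContinuousAt (fun u => u + v1) u1 := by fun_prop
    exact hc.eventually ((isOpen_analyticAt ℂ (φ k)).mem_nhds huv1)
  obtain ⟨r, hr, hball⟩ := Metric.eventually_nhds_iff_ball.1 ((hopen u1 hu1).and hk)
  set U := Metric.ball u1 r with hU
  have hu1U : u1 ∈ U := Metric.mem_ball_self hr
  have : IsDomain (anSub U) := anSub_isDomain U Metric.isOpen_ball
    (convex_ball u1 r).isPreconnected ⟨u1, hu1U⟩
  have hshift : ∀ u, AnalyticAt ℂ (fun u : Fin n → ℂ => u + v1) u := fun u =>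
    analyticAt_id.add analyticAt_const
  let x : Fin n → anSub U := fun j => ⟨fun u => φ j u, φ j, fun u hu => (hball u hu).1 j,
    fun _ => rfl⟩
  let z : anSub U := ⟨fun u => φ k (u + v1), fun u => φ k (u + v1), fun u hu =>
    AnalyticAt.fun_comp (hball u hu).2 (hshift u), fun _ => rfl⟩
  let w : Fin n → anSub U := fun p => ⟨fun u => pd (φ k) p (u + v1),
    fun u => pd (φ k) p (u + v1), fun u hu =>
    AnalyticAt.fun_comp (analyticAt_pd (hball u hu).2 p) (hshift u), fun _ => rfl⟩
  let y : Fin n → ℂ := fun j => φ j v1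
  let e : Option (Fin n ⊕ Fin n) → anSub U := fun i =>
    i.elim z (Sum.elim x (fun j => algebraMap ℂ (anSub U) (y j)))
  let ev : U → anSub U →ₐ[ℂ] ℂ := fun u => (Pi.evalAlgHom ℂ (fun _ : U => ℂ) u).comp (anSub U).val
  have hev : ∀ {σ : Type} (c : σ → anSub U) (R : MvPolynomial σ ℂ) (u : U),
      ev u (aeval c R) = eval (fun i => ev u (c i)) R := by
    intro σ c R u
    have : (ev u).comp (aeval c) = aeval (fun i => ev u (c i)) :=
      MvPolynomial.algHom_ext (fun i => by simp)
    have := DFunLike.congr_fun this R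
    rw [← MvPolynomial.aeval_eq_eval]
    exact this
  have hevx : ∀ a b : anSub U, (∀ u, ev u a = ev u b) → a = b := fun a b h =>
    Subtype.ext (funext h)
  have hee : ∀ u : U, (fun i => ev u (e i)) = fun i =>
      i.elim (φ k (u + v1)) (Sum.elim (fun j => φ j u) fun j => φ j v1) := by
    intro u
    funext i
    rcases i with _ | j | j <;> rfl
  let Q : Fin n → MvPolynomial (Option (Fin n ⊕ Fin n)) ℂ := fun p =>
    - ∑ j, pderiv (some (Sum.inr j)) G * C (pd (φ j) p v1)
  have hmain : ∃ W : MvPolynomial (Option (Fin n)) ℂ, W ≠ 0 ∧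
      aeval (fun i : Option (Fin n) => i.elim z w) W = 0 := by
    refine algebra_main x y z w e rfl G ?_ ?_ Q ?_
    · refine hevx _ _ fun u => ?_
      rw [hev, hee, map_zero]
      exact hGR u v1 (hball u u.2).1 hv1 (hball u u.2).2
    · intro h
      have := congrArg (ev ⟨u1, hu1U⟩) h
      rw [hev, hee, map_zero] at this
      exact hne this
    · intro p
      refine hevx _ _ fun u => ?_
      have hline : ∀ a : Fin n → ℂ, HasDerivAt (fun t : ℂ => a + t • (Pi.single p 1 : Fin n → ℂ))
          (Pi.single p 1) 0 := by
        intro a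
        simpa using ((hasDerivAt_id (0 : ℂ)).smul_const (Pi.single p 1 : Fin n → ℂ)).const_add a
      have hder : ∀ (f : (Fin n → ℂ) → ℂ) (a : Fin n → ℂ), AnalyticAt ℂ f a →
          HasDerivAt (fun t : ℂ => f (a + t • (Pi.single p 1 : Fin n → ℂ))) (pd f p a) 0 := by
        intro f a hf
        have h1 : HasFDerivAt f (fderiv ℂ f a) (a + (0 : ℂ) • (Pi.single p 1 : Fin n → ℂ)) := by
          simpa using hf.differentiableAt.hasFDerivAt
        exact h1.comp_hasDerivAt 0 (hline a)
      let c : ℂ → Option (Fin n ⊕ Fin n) → ℂ := fun t i =>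
        i.elim (φ k (u + v1 + t • (Pi.single p 1 : Fin n → ℂ)))
          (Sum.elim (fun j => φ j u) fun j => φ j (v1 + t • (Pi.single p 1 : Fin n → ℂ)))
      let c' : Option (Fin n ⊕ Fin n) → ℂ := fun i =>
        i.elim (pd (φ k) p (u + v1)) (Sum.elim (fun j => 0) fun j => pd (φ j) p v1)
      have hc : ∀ i, HasDerivAt (fun t => c t i) (c' i) 0 := by
        intro i
        rcases i with _ | j | j
        · exact hder _ _ (hball u u.2).2
        · exact hasDerivAt_const _ _
        · exact hder _ _ (hv1 j)
      have hG' := hasDerivAt_eval c c' 0 hc G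
      have hzero : (fun t => eval (c t) G) =ᶠ[𝓝 0] fun _ => 0 := by
        have t1 : Tendsto (fun t : ℂ => v1 + t • (Pi.single p 1 : Fin n → ℂ)) (𝓝 0) (𝓝 v1) := by
          simpa using (hline v1).continuousAt.tendsto
        have t2 : Tendsto (fun t : ℂ => (u : Fin n → ℂ) + v1 + t • (Pi.single p 1 : Fin n → ℂ))
            (𝓝 0) (𝓝 (u + v1)) := by
          simpa using (hline (u + v1)).continuousAt.tendsto
        filter_upwards [t1.eventually (hopen v1 hv1),
          t2.eventually ((isOpen_analyticAt ℂ (φ k)).mem_nhds (hball u u.2).2)] with t h1 h2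
        have h2 : AnalyticAt ℂ (φ k) ((u : Fin n → ℂ) + v1 + t • (Pi.single p 1 : Fin n → ℂ)) := h2
        have := hGR u _ (hball u u.2).1 h1 (by rw [← add_assoc]; exact h2)
        rw [← add_assoc] at this
        exact this
      have h0 := hG'.unique ((hasDerivAt_const (0 : ℂ) (0 : ℂ)).congr_of_eventuallyEq hzero)
      have hc0 : c 0 = fun i => ev u (e i) := by
        rw [hee]
        funext i
        rcases i with _ | j | j <;> simp [c]
      rw [Fintype.sum_option, Fintype.sum_sum_type, hc0] at h0
      rw [map_mul, hev, hev]
      have hwu : ev u (w p) = pd (φ k) p (u + v1) := rfl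
      rw [hwu]
      simp only [c', Option.elim, Sum.elim_inl, Sum.elim_inr, mul_zero, Finset.sum_const_zero,
        zero_add] at h0
      simp only [Q, map_neg, map_sum, map_mul, eval_C]
      exact eq_neg_of_add_eq_zero_left h0
  · obtain ⟨W, hW0, hW⟩ := hmain
    refine ⟨W, hW0, fun u hu _ => ?_⟩
    refine extend (φ k) (hmero k) W ((fun u => u - v1) ⁻¹' U) ?_ ?_ ?_ u (hu k)
    · exact Metric.isOpen_ball.preimage (by fun_prop)
    · exact ⟨u1 + v1, by simpa using hu1U⟩
    · intro u hu
      have h1 := congrArg (ev ⟨u - v1, hu⟩) hW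
      rw [hev, map_zero] at h1
      rw [← h1]
      congr 2
      funext i
      rcases i with _ | p
      · change φ k u = φ k (u - v1 + v1)
        rw [sub_add_cancel]
      · change pd (φ k) p u = pd (φ k) p (u - v1 + v1)
        rw [sub_add_cancel]
end

section
/- Suppose the meromorphic mapping Φ = (φ₁,…,φ_n) admits an algebraic addition theorem. Then there exist constants α_{kp} ∈ ℂ (k, p = 1,…,n) such that the function θ(u) := Σ_{k,p=1}^n α_{kp} ∂φ_k/∂u_p(u) satisfies: (i) there is a nonzero polynomial V ∈ ℂ[t, x₁,…,x_n] with V(θ(u); φ₁(u),…,φ_n(u)) = 0 for every u at which φ₁,…,φ_n and their first-order partial derivatives are analytic; and (ii) every first-order partial derivative is a rational function of θ and the φ's: for each k, p there are polynomials A_{kp}, B_{kp} ∈ ℂ[t, x₁,…,x_n] with B_{kp}(θ(u); φ₁(u),…,φ_n(u)) not identically zero and ∂φ_k/∂u_p(u) = A_{kp}(θ(u); φ₁(u),…,φ_n(u)) / B_{kp}(θ(u); φ₁(u),…,φ_n(u)) for every u at which all these functions are analytic and B_{kp}(θ(u); φ₁(u),…,φ_n(u)) ≠ 0. -/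
open MvPolynomial

theorem alg_prim {k M : Type*} [Field k] [CharZero k] [Field M] [Algebra k M]
    {σ ι : Type*} [Fintype ι] (b : σ → M) (f : ι → M)
    (hf : ∀ i, IsAlgebraic (IntermediateField.adjoin k (Set.range b)) (f i)) :
    ∃ α : ι → k, ∀ i, f i ∈ IntermediateField.adjoin k
      (Set.range (fun o : Option σ => o.elim (∑ i, α i • f i) b)) := by
  classical
  set K := IntermediateField.adjoin k (Set.range b) with hK
  have : CharZero K := charZero_of_injective_algebraMap (algebraMap k K).injective
  set L := IntermediateField.adjoin K (Set.range f) with hL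
  have : FiniteDimensional K L := by
    apply IntermediateField.finiteDimensional_adjoin
    rintro x ⟨i, rfl⟩
    exact (hf i).isIntegral
  have : Finite (IntermediateField K L) :=
    (Field.exists_primitive_element_iff_finite_intermediateField K L).1
      ⟨inferInstance, Field.exists_primitive_element K L⟩
  let f' : ι → L := fun i => ⟨f i, IntermediateField.subset_adjoin _ _ ⟨i, rfl⟩⟩
  let T : (ι → k) →ₗ[k] L := Fintype.linearCombination k f'
  have hgen : ∀ F : IntermediateField K L, (∀ i, f' i ∈ F) → F = ⊤ := by
    intro F hF
    rw [eq_top_iff]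
    intro x _
    have : L ≤ F.map L.val := by
      refine IntermediateField.adjoin_le_iff.2 ?_
      rintro _ ⟨i, rfl⟩
      exact ⟨f' i, hF i, rfl⟩
    obtain ⟨y, hy, hyx⟩ := this x.2
    have : y = x := Subtype.ext hyx
    exact this ▸ hy
  obtain ⟨α, hα⟩ : ∃ α : ι → k, IntermediateField.adjoin K {T α} = ⊤ := by
    by_contra! hcon
    let p : {F : IntermediateField K L // F ≠ ⊤} → Subspace k (ι → k) := fun F =>
      ((F.1.toSubalgebra.toSubmodule).restrictScalars k).comap T
    have hc : ⋃ i, (p i : Set (ι → k)) = Set.univ := by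
      rw [Set.eq_univ_iff_forall]
      intro α
      rw [Set.mem_iUnion]
      exact ⟨⟨_, hcon α⟩, IntermediateField.mem_adjoin_simple_self K (T α)⟩
    obtain ⟨F, hF⟩ := Subspace.exists_eq_top_of_iUnion_eq_univ hc
    apply F.2
    apply hgen
    intro i
    have : (Pi.single i 1 : ι → k) ∈ p F := by rw [hF]; trivial
    have h2 : T (Pi.single i 1) ∈ F.1 := this
    simpa [T] using h2
  refine ⟨α, fun i => ?_⟩
  set N := IntermediateField.adjoin k
      (Set.range (fun o : Option σ => o.elim (∑ i, α i • f i) b)) with hN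
  have hKN : K ≤ N := by
    rw [hK, IntermediateField.adjoin_le_iff]
    rintro _ ⟨j, rfl⟩
    exact IntermediateField.subset_adjoin _ _ ⟨some j, rfl⟩
  have hθ : ((T α : L) : M) = ∑ i, α i • f i := by
    simp [T, Fintype.linearCombination_apply, f']
  have hfi : f' i ∈ IntermediateField.adjoin K {T α} := by rw [hα]; trivial
  have h3 : f i ∈ IntermediateField.adjoin K {((T α : L) : M)} := by
    have : f i ∈ (IntermediateField.adjoin K {T α}).map L.val := ⟨f' i, hfi, rfl⟩
    rw [IntermediateField.adjoin_map] at this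
    simpa using this
  have hθN : ((T α : L) : M) ∈ N := by
    rw [hθ]
    exact IntermediateField.subset_adjoin _ _ ⟨none, rfl⟩
  have h4 : IntermediateField.adjoin K {((T α : L) : M)} ≤
      IntermediateField.extendScalars hKN := by
    refine IntermediateField.adjoin_le_iff.2 ?_
    exact Set.singleton_subset_iff.2 hθN
  exact h4 h3

theorem alg_dep_s4 {k M : Type*} [Field k] [Field M] [Algebra k M]
    {σ : Type*} (b : σ → M) (t : M)
    (ht : IsAlgebraic (IntermediateField.adjoin k (Set.range b)) t) :
    ∃ V : MvPolynomial (Option σ) k, V ≠ 0 ∧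
      aeval (fun o : Option σ => o.elim t b) V = 0 := by
  by_contra! hcon
  have hind : AlgebraicIndependent k (fun o : Option σ => o.elim t b) := by
    rw [algebraicIndependent_iff]
    intro p hp
    by_contra h
    exact hcon p h hp
  have hb : AlgebraicIndependent k b := hind.comp some (Option.some_injective _)
  have := (hb.option_iff_transcendental t).1 hind
  apply this
  have h5 := ht
  open scoped IntermediateField.algebraAdjoinAdjoin in
  rw [IsFractionRing.isAlgebraic_iff (Algebra.adjoin k (Set.range b)) (IntermediateField.adjoin k (Set.range b)) M]
  exact h5

theorem alg_root {k M : Type*} [Field k] [Field M] [Algebra k M]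
    {τ : Type*} (K : IntermediateField k M) (z : τ → M) (hz : ∀ j, z j ∈ K) (t : M)
    (G : MvPolynomial (Option τ) k)
    (hG : aeval (fun o : Option τ => o.elim t z) G = 0)
    (hq : aeval z (optionEquivLeft k τ G).leadingCoeff ≠ 0) : IsAlgebraic K t := by
  let z' : τ → K := fun j => ⟨z j, hz j⟩
  let ρ : MvPolynomial τ k →ₐ[k] K := aeval z'
  have hρ : ∀ q, ((ρ q : K) : M) = aeval z q := by
    intro q
    have : K.val.comp ρ = aeval z := by
      ext j; simp [ρ, z']
    exact DFunLike.congr_fun this q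
  refine ⟨(optionEquivLeft k τ G).map ρ.toRingHom, ?_, ?_⟩
  · intro h
    apply hq
    have := congrArg (fun P => Polynomial.coeff P (optionEquivLeft k τ G).natDegree) h
    simp only [Polynomial.coeff_map, Polynomial.coeff_zero] at this
    rw [← hρ]
    have h2 : ρ (optionEquivLeft k τ G).leadingCoeff = 0 := this
    rw [h2]; rfl
  · rw [← hG]
    rw [Polynomial.aeval_def, Polynomial.eval₂_map]
    have h1 : ((algebraMap K M).comp ρ.toRingHom) = (aeval (R := k) z).toRingHom := by
      ext q
      · simp [ρ]
      · simp [ρ, z']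
    rw [h1]
    have h2 : (Polynomial.eval₂RingHom (aeval (R := k) z).toRingHom t).comp
       (optionEquivLeft k τ).toRingHom =
         (aeval (R := k) (fun o : Option τ => o.elim t z)).toRingHom := by
      apply MvPolynomial.ringHom_ext
      · intro r; simp [optionEquivLeft_C]
      · intro o; cases o <;> simp
    exact DFunLike.congr_fun h2 G
open Filter Topology

/-- entire functions on `ℂⁿ` -/
def Ent {n : ℕ} (g : (Fin n → ℂ) → ℂ) : Prop := ∀ u, AnalyticAt ℂ g u

theorem ent_freq {n : ℕ} {h : (Fin n → ℂ) → ℂ} (hh : Ent h) (h0 : ∃ u, h u ≠ 0)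
    (u : Fin n → ℂ) : ∃ᶠ x in 𝓝 u, h x ≠ 0 := by
  intro hcon
  obtain ⟨w, hw⟩ := h0
  apply hw
  have h1 : h =ᶠ[𝓝 u] 0 := by
    filter_upwards [hcon] with x hx
    simpa using hx
  have := AnalyticOnNhd.eqOn_zero_of_preconnected_of_eventuallyEq_zero
    (U := Set.univ) (f := h) (𝕜 := ℂ) (fun x _ => hh x) isPreconnected_univ (Set.mem_univ u) h1
  exact this (Set.mem_univ w)

theorem ent_mul_ne {n : ℕ} {g h : (Fin n → ℂ) → ℂ} (hg : Ent g) (hh : Ent h)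
    (g0 : ∃ u, g u ≠ 0) (h0 : ∃ u, h u ≠ 0) : ∃ u, g u * h u ≠ 0 := by
  obtain ⟨w, hw⟩ := g0
  have h1 : ∀ᶠ x in 𝓝 w, g x ≠ 0 := (hg w).continuousAt.eventually_ne hw
  obtain ⟨x, hx, hx'⟩ := ((ent_freq hh h0 w).and_eventually h1).exists
  exact ⟨x, mul_ne_zero hx' hx⟩

/-- the filter of generic properties -/
def gen (n : ℕ) : Filter (Fin n → ℂ) where
  sets := {s | ∃ h : (Fin n → ℂ) → ℂ, Ent h ∧ (∃ u, h u ≠ 0) ∧ ∀ u, h u ≠ 0 → u ∈ s}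
  univ_sets := ⟨fun _ => 1, fun _ => analyticAt_const, ⟨0, one_ne_zero⟩, fun _ _ => trivial⟩
  sets_of_superset := by
    rintro s t ⟨h, h1, h2, h3⟩ hst
    exact ⟨h, h1, h2, fun u hu => hst (h3 u hu)⟩
  inter_sets := by
    rintro s t ⟨h, h1, h2, h3⟩ ⟨h', h1', h2', h3'⟩
    refine ⟨fun u => h u * h' u, fun u => (h1 u).mul (h1' u), ent_mul_ne h1 h1' h2 h2', ?_⟩
    intro u hu
    exact ⟨h3 u (left_ne_zero_of_mul hu), h3' u (right_ne_zero_of_mul hu)⟩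

theorem gen_iff {n : ℕ} {P : (Fin n → ℂ) → Prop} : (∀ᶠ u in gen n, P u) ↔
    ∃ h : (Fin n → ℂ) → ℂ, Ent h ∧ (∃ u, h u ≠ 0) ∧ ∀ u, h u ≠ 0 → P u := Iff.rfl

instance gen_neBot (n : ℕ) : (gen n).NeBot := by
  rw [← Filter.empty_mem_iff_bot.not.trans Filter.neBot_iff.symm |>.symm.symm]
  rintro ⟨h, _, ⟨u, hu⟩, h3⟩
  exact h3 u hu

theorem gen_freq {n : ℕ} {P : (Fin n → ℂ) → Prop} (hP : ∀ᶠ u in gen n, P u) (u : Fin n → ℂ) :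
    ∃ᶠ x in 𝓝 u, P x := by
  obtain ⟨h, h1, h2, h3⟩ := gen_iff.1 hP
  exact (ent_freq h1 h2 u).mono h3

theorem gen_zero {n : ℕ} {f : (Fin n → ℂ) → ℂ} (hf : ∀ᶠ u in gen n, f u = 0) {u : Fin n → ℂ}
    (hc : ContinuousAt f u) : f u = 0 := by
  by_contra h
  obtain ⟨x, hx, hx'⟩ := ((gen_freq hf u).and_eventually (hc.eventually_ne h)).exists
  exact hx' hx

theorem gen_tendsto_add {n : ℕ} (a : Fin n → ℂ) : Tendsto (fun u => u + a) (gen n) (gen n) := by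
  rintro s ⟨h, h1, ⟨w, hw⟩, h3⟩
  refine ⟨fun u => h (u + a), fun u => ?_, ⟨w - a, by simpa using hw⟩, fun u hu => h3 _ hu⟩
  exact (h1 (u + a)).comp_of_eq (f := fun u => u + a) (by fun_prop) rfl

theorem gen_tendsto_neg {n : ℕ} : Tendsto (fun u => -u) (gen n) (gen n) := by
  rintro s ⟨h, h1, ⟨w, hw⟩, h3⟩
  refine ⟨fun u => h (-u), fun u => ?_, ⟨-w, by simpa using hw⟩, fun u hu => h3 _ hu⟩
  exact (h1 (-u)).comp_of_eq (f := fun u => -u) (by fun_prop) rfl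

namespace Mero
variable {n : ℕ} {f g : (Fin n → ℂ) → ℂ}

theorem dichot (hf : Mero f) : (∀ᶠ u in gen n, f u = 0) ∨ (∀ᶠ u in gen n, f u ≠ 0) := by
  obtain ⟨g, h, hg, hh, h0, hfe⟩ := hf
  by_cases g0 : ∃ u, g u ≠ 0
  · right
    refine ⟨fun u => g u * h u, fun u => (hg u).mul (hh u), ent_mul_ne hg hh g0 h0, ?_⟩
    intro u hu
    have h1 := right_ne_zero_of_mul hu
    change f u ≠ 0
    rw [hfe u h1]
    exact div_ne_zero (left_ne_zero_of_mul hu) h1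
  · left
    push Not at g0
    refine ⟨h, hh, h0, fun u hu => ?_⟩
    change f u = 0
    rw [hfe u hu, g0, zero_div]

theorem gen_ne (hf : Mero f) {u : Fin n → ℂ} (hc : ContinuousAt f u) (hu : f u ≠ 0) :
    ∀ᶠ u in gen n, f u ≠ 0 :=
  hf.dichot.resolve_left fun h => hu (gen_zero h hc)

theorem analytic (hf : Mero f) : ∀ᶠ u in gen n, AnalyticAt ℂ f u := by
  obtain ⟨g, h, hg, hh, h0, hfe⟩ := hf
  refine ⟨h, hh, h0, fun u hu => ?_⟩
  refine ((hg u).div (hh u) hu).congr ?_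
  filter_upwards [(hh u).continuousAt.eventually_ne hu] with x hx
  exact (hfe x hx).symm

theorem const (a : ℂ) : Mero (fun _ : Fin n → ℂ => a) :=
  ⟨fun _ => a, fun _ => 1, fun _ => analyticAt_const, fun _ => analyticAt_const,
    ⟨0, one_ne_zero⟩, by simp⟩

theorem add (hf : Mero f) (hg : Mero g) : Mero (fun u => f u + g u) := by
  obtain ⟨a, h, ha, hh, h0, hfe⟩ := hf
  obtain ⟨b, k, hb, hk, k0, hge⟩ := hg
  refine ⟨fun u => a u * k u + h u * b u, fun u => h u * k u,
    fun u => ((ha u).mul (hk u)).add ((hh u).mul (hb u)), fun u => (hh u).mul (hk u),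
    ent_mul_ne hh hk h0 k0, fun u hu => ?_⟩
  have h1 := left_ne_zero_of_mul hu
  have h2 := right_ne_zero_of_mul hu
  beta_reduce
  rw [hfe u h1, hge u h2, div_add_div _ _ h1 h2]

theorem mul (hf : Mero f) (hg : Mero g) : Mero (fun u => f u * g u) := by
  obtain ⟨a, h, ha, hh, h0, hfe⟩ := hf
  obtain ⟨b, k, hb, hk, k0, hge⟩ := hg
  refine ⟨fun u => a u * b u, fun u => h u * k u,
    fun u => ((ha u).mul (hb u)), fun u => (hh u).mul (hk u),
    ent_mul_ne hh hk h0 k0, fun u hu => ?_⟩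
  have h1 := left_ne_zero_of_mul hu
  have h2 := right_ne_zero_of_mul hu
  beta_reduce
  rw [hfe u h1, hge u h2, div_mul_div_comm]

theorem sub (hf : Mero f) (hg : Mero g) : Mero (fun u => f u - g u) := by
  have := hf.add ((Mero.const (-1)).mul hg)
  simpa [sub_eq_add_neg] using this

theorem sum {ι : Type*} (s : Finset ι) (F : ι → (Fin n → ℂ) → ℂ) (hF : ∀ i, Mero (F i)) :
    Mero (fun u => ∑ i ∈ s, F i u) := by
  classical
  induction s using Finset.induction_on with
  | empty => simpa using Mero.const 0
  | insert a s ha ih =>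
    simp_rw [Finset.sum_insert ha]
    exact (hF a).add ih

theorem poly {σ : Type*} (F : σ → (Fin n → ℂ) → ℂ) (hF : ∀ i, Mero (F i))
    (P : MvPolynomial σ ℂ) : Mero (fun u => eval (fun i => F i u) P) := by
  induction P using MvPolynomial.induction_on with
  | C a => simpa using Mero.const a
  | add p q hp hq => simpa using hp.add hq
  | mul_X p i hp => simpa using hp.mul (hF i)

theorem addRight (hf : Mero f) (a : Fin n → ℂ) : Mero (fun u => f (u + a)) := by
  obtain ⟨g, h, hg, hh, ⟨w, hw⟩, hfe⟩ := hf
  refine ⟨fun u => g (u + a), fun u => h (u + a), fun u => ?_, fun u => ?_,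
    ⟨w - a, by simpa using hw⟩, fun u hu => hfe _ hu⟩
  · exact (hg (u + a)).comp_of_eq (f := fun u => u + a) (by fun_prop) rfl
  · exact (hh (u + a)).comp_of_eq (f := fun u => u + a) (by fun_prop) rfl

theorem addLeft (hf : Mero f) (a : Fin n → ℂ) : Mero (fun u => f (a + u)) := by
  simpa [add_comm] using hf.addRight a

theorem neg (hf : Mero f) : Mero (fun u => f (-u)) := by
  obtain ⟨g, h, hg, hh, ⟨w, hw⟩, hfe⟩ := hf
  refine ⟨fun u => g (-u), fun u => h (-u), fun u => ?_, fun u => ?_,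
    ⟨-w, by simpa using hw⟩, fun u hu => hfe _ hu⟩
  · exact (hg (-u)).comp_of_eq (f := fun u => -u) (by fun_prop) rfl
  · exact (hh (-u)).comp_of_eq (f := fun u => -u) (by fun_prop) rfl

theorem _root_.ent_pd (hg : Ent g) (p : Fin n) : Ent (pd g p) := fun u =>
  ((ContinuousLinearMap.apply ℂ ℂ (Pi.single p 1 : Fin n → ℂ)).analyticAt _).comp (hg u).fderiv

theorem pd (hf : Mero f) (p : Fin n) : Mero (pd f p) := by
  obtain ⟨g, h, hg, hh, h0, hfe⟩ := hf
  refine ⟨fun u => _root_.pd g p u * h u - g u * _root_.pd h p u, fun u => h u * h u,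
    fun u => ((ent_pd hg p u).mul (hh u)).sub ((hg u).mul (ent_pd hh p u)),
    fun u => (hh u).mul (hh u), ent_mul_ne hh hh h0 h0, fun u hu => ?_⟩
  have h1 := left_ne_zero_of_mul hu
  have h2 : f =ᶠ[𝓝 u] fun x => g x / h x := by
    filter_upwards [(hh u).continuousAt.eventually_ne h1] with x hx
    exact hfe x hx
  have hfa : AnalyticAt ℂ f u := ((hg u).div (hh u) h1).congr h2.symm
  have h3 : g =ᶠ[𝓝 u] fun x => f x * h x := by
    filter_upwards [(hh u).continuousAt.eventually_ne h1] with x hx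
    rw [hfe x hx]
    field_simp
  beta_reduce
  unfold _root_.pd
  rw [h3.fderiv_eq, fderiv_fun_mul hfa.differentiableAt (hh u).differentiableAt, h3.eq_of_nhds]
  simp
  field_simp
  ring

end Mero

theorem cont_poly {n : ℕ} {σ : Type*} (F : σ → (Fin n → ℂ) → ℂ) (u : Fin n → ℂ)
    (hF : ∀ i, ContinuousAt (F i) u) (P : MvPolynomial σ ℂ) :
    ContinuousAt (fun u => eval (fun i => F i u) P) u := by
  induction P using MvPolynomial.induction_on with
  | C a => simpa using continuousAt_const
  | add p q hp hq => simp only [map_add]; exact hp.add hq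
  | mul_X p i hp => simp only [map_mul, eval_X]; exact hp.mul (hF i)

theorem chain_poly {n : ℕ} {σ : Type*} [Fintype σ] (F : σ → (Fin n → ℂ) → ℂ) (u : Fin n → ℂ)
    (hF : ∀ i, DifferentiableAt ℂ (F i) u) (P : MvPolynomial σ ℂ) (p : Fin n) :
    DifferentiableAt ℂ (fun u => eval (fun i => F i u) P) u ∧
    pd (fun u => eval (fun i => F i u) P) p u =
      ∑ i, eval (fun i => F i u) (pderiv i P) * pd (F i) p u := by
  classical
  unfold pd
  induction P using MvPolynomial.induction_on with
  | C a => simp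
  | add P q hp hq =>
    refine ⟨by simp only [map_add]; exact hp.1.add hq.1, ?_⟩
    simp only [map_add]
    rw [fderiv_fun_add hp.1 hq.1]
    simp [hp.2, hq.2, add_mul, Finset.sum_add_distrib]
  | mul_X P i hp =>
    refine ⟨by simp only [map_mul, eval_X]; exact hp.1.mul (hF i), ?_⟩
    simp only [map_mul, eval_X]
    rw [fderiv_fun_mul hp.1 (hF i)]
    simp [hp.2, Derivation.leibniz, add_mul, Finset.sum_add_distrib, pderiv_X, Pi.single_apply,
      Finset.mul_sum, mul_assoc]
    simp [apply_ite, ite_mul]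

theorem indep_image {n : ℕ} (φ : Fin n → (Fin n → ℂ) → ℂ) (hindep : AnalyticallyIndep φ) :
    ∃ z : Fin n → ℂ, ∃ ε > 0, ∀ x : Fin n → ℂ, (∀ j, x j ∈ Metric.ball (z j) ε) →
      ∃ u, (∀ j, AnalyticAt ℂ (φ j) u) ∧ ∀ j, φ j u = x j := by
  obtain ⟨w, hw, hdet⟩ := hindep
  let Φ : (Fin n → ℂ) → (Fin n → ℂ) := fun u j => φ j u
  have hΦ : HasStrictFDerivAt Φ (ContinuousLinearMap.pi fun j => fderiv ℂ (φ j) w) w :=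
    hasStrictFDerivAt_pi.2 fun j => (hw j).hasStrictFDerivAt
  have hsurj : (ContinuousLinearMap.pi fun j => fderiv ℂ (φ j) w).range = ⊤ := by
    rw [LinearMap.range_eq_top]
    intro y
    have hu : IsUnit (Matrix.of fun k p => pd (φ k) p w) := by
      rw [Matrix.isUnit_iff_isUnit_det]
      exact isUnit_iff_ne_zero.2 hdet
    obtain ⟨x, hx⟩ := (Matrix.mulVec_surjective_iff_isUnit.2 hu) y
    refine ⟨x, ?_⟩
    rw [← hx]
    ext k
    have hxs : x = ∑ p, x p • (Pi.single p 1 : Fin n → ℂ) := by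
      ext i; simp [Finset.sum_apply, Pi.single_apply]
    change fderiv ℂ (φ k) w x = _
    conv_lhs => rw [hxs]
    simp [Matrix.mulVec, dotProduct, pd, mul_comm]
  have hmap := hΦ.map_nhds_eq_of_surj hsurj
  have hN : {u | ∀ j, AnalyticAt ℂ (φ j) u} ∈ 𝓝 w :=
    Filter.eventually_all.2 fun j => (hw j).eventually_analyticAt
  have himg := Filter.image_mem_map (m := Φ) hN
  rw [hmap, Metric.mem_nhds_iff] at himg
  obtain ⟨ε, hε, hsub⟩ := himg
  refine ⟨Φ w, ε, hε, fun x hx => ?_⟩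
  obtain ⟨u, hu, hux⟩ := hsub (show x ∈ Metric.ball (Φ w) ε from
    (dist_pi_lt_iff hε).2 fun j => hx j)
  exact ⟨u, hu, fun j => congrFun hux j⟩

theorem indep2 {n : ℕ} (φ : Fin n → (Fin n → ℂ) → ℂ) (hindep : AnalyticallyIndep φ)
    (q : MvPolynomial (Fin n ⊕ Fin n) ℂ) (hq : q ≠ 0) :
    ∃ u v, (∀ j, AnalyticAt ℂ (φ j) u) ∧ (∀ j, AnalyticAt ℂ (φ j) v) ∧
      eval (Sum.elim (fun j => φ j u) fun j => φ j v) q ≠ 0 := by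
  obtain ⟨z, ε, hε, H⟩ := indep_image φ hindep
  by_contra! hcon
  apply hq
  refine MvPolynomial.funext_set (fun i => Metric.ball (Sum.elim z z i) ε)
    (fun i => infinite_of_mem_nhds _ (Metric.ball_mem_nhds _ hε)) ?_
  intro x hx
  obtain ⟨u, hu, hux⟩ := H (fun j => x (Sum.inl j)) fun j => hx (Sum.inl j) trivial
  obtain ⟨v, hv, hvx⟩ := H (fun j => x (Sum.inr j)) fun j => hx (Sum.inr j) trivial
  have := hcon u v hu hv
  rw [map_zero, ← this]
  congr 1
  congr 1
  ext i
  cases i <;> simp [hux, hvx]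

/-- arguments of the addition polynomial -/
noncomputable def aarg {n : ℕ} (t : ℂ) (x y : Fin n → ℂ) : Option (Fin n ⊕ Fin n) → ℂ :=
  fun i => i.elim t (Sum.elim x y)

/-- the vanishing domain -/
def Dom {n : ℕ} (φ : Fin n → (Fin n → ℂ) → ℂ) (k : Fin n) (u v : Fin n → ℂ) : Prop :=
  (∀ j, AnalyticAt ℂ (φ j) u) ∧ (∀ j, AnalyticAt ℂ (φ j) v) ∧ AnalyticAt ℂ (φ k) (u + v)

theorem ana_addLeft {n : ℕ} {f : (Fin n → ℂ) → ℂ} {u v : Fin n → ℂ}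
    (h : AnalyticAt ℂ f (u + v)) : AnalyticAt ℂ (fun v => f (u + v)) v :=
  h.comp_of_eq (f := fun v => u + v) (by fun_prop) rfl

theorem ana_addRight {n : ℕ} {f : (Fin n → ℂ) → ℂ} {u v : Fin n → ℂ}
    (h : AnalyticAt ℂ f (u + v)) : AnalyticAt ℂ (fun u => f (u + v)) u :=
  h.comp_of_eq (f := fun u => u + v) (by fun_prop) rfl

theorem indep3 {n : ℕ} (φ : Fin n → (Fin n → ℂ) → ℂ) (hmero : ∀ k, Mero (φ k))
    (hindep : AnalyticallyIndep φ)
    (q : MvPolynomial (Fin n ⊕ Fin n) ℂ) (hq : q ≠ 0) (k : Fin n) :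
    ∃ u v, Dom φ k u v ∧ eval (Sum.elim (fun j => φ j u) fun j => φ j v) q ≠ 0 := by
  obtain ⟨u, v, hu, hv, huv⟩ := indep2 φ hindep q hq
  let F : (Fin n ⊕ Fin n) → (Fin n → ℂ) → ℂ := fun i v => Sum.elim (fun j => φ j u) (fun j => φ j v) i
  have hF : ∀ i, Mero (F i) := by
    rintro (j | j)
    · exact Mero.const _
    · exact hmero j
  have hc : ∀ i, ContinuousAt (F i) v := by
    rintro (j | j)
    · exact continuousAt_const
    · exact (hv j).continuousAt
  have h1 := (Mero.poly F hF q).gen_ne (cont_poly F v hc q) huv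
  have h2 : ∀ᶠ v in gen n, ∀ j, AnalyticAt ℂ (φ j) v :=
    eventually_all.2 fun j => (hmero j).analytic
  have h3 : ∀ᶠ v in gen n, AnalyticAt ℂ (φ k) (v + u) :=
    (gen_tendsto_add u).eventually (hmero k).analytic
  obtain ⟨v', ha, hb, hd⟩ := (h1.and (h2.and h3)).exists
  exact ⟨u, v', ⟨hu, hb, add_comm v' u ▸ hd⟩, ha⟩

theorem degreeOf_none_zero {τ : Type*} (G : MvPolynomial (Option τ) ℂ) (h : G.degreeOf none = 0) :
    ∃ q : MvPolynomial τ ℂ, G = rename some q := by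
  have h1 : (optionEquivLeft ℂ τ G).natDegree = 0 := by rw [natDegree_optionEquivLeft, h]
  obtain ⟨q, hq⟩ := Polynomial.natDegree_eq_zero.1 h1
  refine ⟨q, ?_⟩
  apply (optionEquivLeft ℂ τ).injective
  rw [← hq]
  have : ((optionEquivLeft ℂ τ).toAlgHom.comp (rename some)) =
    (Algebra.ofId (MvPolynomial τ ℂ) (Polynomial (MvPolynomial τ ℂ))).restrictScalars ℂ := by
    ext i
    simp [Algebra.ofId_apply]
  exact (DFunLike.congr_fun this q).symm

theorem pderiv_none_ne {τ : Type*} (G : MvPolynomial (Option τ) ℂ) (h : G.degreeOf none ≠ 0) :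
    pderiv none G ≠ 0 ∧ (pderiv none G).degreeOf none < G.degreeOf none := by
  have key : ∀ G : MvPolynomial (Option τ) ℂ, optionEquivLeft ℂ τ (pderiv none G) =
      Polynomial.derivative (optionEquivLeft ℂ τ G) := by
    intro G
    induction G using MvPolynomial.induction_on with
    | C a => simp [optionEquivLeft_C]
    | add p q hp hq => simp [hp, hq]
    | mul_X p i hp =>
      classical
      cases i <;> simp [hp, Derivation.leibniz, pderiv_X, Polynomial.derivative_mul] <;> ring
  rw [← natDegree_optionEquivLeft, ← natDegree_optionEquivLeft, key]
  rw [← natDegree_optionEquivLeft] at h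
  refine ⟨fun h0 => h ?_, Polynomial.natDegree_derivative_lt h⟩
  apply Polynomial.derivative_eq_zero.1
  rw [← key, h0, map_zero]

theorem min_poly {n : ℕ} (φ : Fin n → (Fin n → ℂ) → ℂ) (hmero : ∀ k, Mero (φ k))
    (hindep : AnalyticallyIndep φ) (haat : AdmitsAAT φ) (k : Fin n) :
    ∃ G : MvPolynomial (Option (Fin n ⊕ Fin n)) ℂ,
      (∀ u v, Dom φ k u v →
        eval (aarg (φ k (u + v)) (fun j => φ j u) fun j => φ j v) G = 0) ∧
      ∃ u v, Dom φ k u v ∧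
        eval (aarg (φ k (u + v)) (fun j => φ j u) fun j => φ j v) (pderiv none G) ≠ 0 := by
  let S : MvPolynomial (Option (Fin n ⊕ Fin n)) ℂ → Prop := fun G => G ≠ 0 ∧
    ∀ u v, Dom φ k u v → eval (aarg (φ k (u + v)) (fun j => φ j u) fun j => φ j v) G = 0
  have hS : ∃ d, ∃ G, S G ∧ G.degreeOf none = d := by
    obtain ⟨G, hG, hv⟩ := haat k
    refine ⟨_, G, ⟨?_, fun u v h => hv u v h.1 h.2.1 h.2.2⟩, rfl⟩
    rintro rfl
    simp at hG
  classical
  obtain ⟨G, hG, hd⟩ := Nat.find_spec hS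
  refine ⟨G, hG.2, ?_⟩
  have h0 : G.degreeOf none ≠ 0 := by
    intro h0
    obtain ⟨q, hq⟩ := degreeOf_none_zero G h0
    have hq0 : q ≠ 0 := by
      rintro rfl
      exact hG.1 (by simpa using hq)
    obtain ⟨u, v, hD, hne⟩ := indep3 φ hmero hindep q hq0 k
    apply hne
    have := hG.2 u v hD
    rw [hq, eval_rename] at this
    exact this
  obtain ⟨h1, h2⟩ := pderiv_none_ne G h0
  by_contra! hcon
  exact Nat.find_min hS (hd ▸ h2) ⟨_, ⟨h1, hcon⟩, rfl⟩

/-- an ultrafilter of generic sets -/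
noncomputable def genU (n : ℕ) : Ultrafilter (Fin n → ℂ) := Ultrafilter.of (gen n)

/-- the field of germs of functions along `genU` -/
def GM (n : ℕ) : Type := Filter.Germ (genU n : Filter (Fin n → ℂ)) ℂ

noncomputable instance GM.field (n : ℕ) : Field (GM n) :=
  inferInstanceAs (Field (Filter.Germ (genU n : Filter (Fin n → ℂ)) ℂ))

/-- germ of a function, as a ring homomorphism -/
noncomputable def clsR (n : ℕ) : ((Fin n → ℂ) → ℂ) →+* GM n :=
  Filter.Germ.coeRingHom (genU n : Filter (Fin n → ℂ))

noncomputable instance GM.algebra (n : ℕ) : Algebra ℂ (GM n) :=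
  ((clsR n).comp (algebraMap ℂ ((Fin n → ℂ) → ℂ))).toAlgebra

/-- germ of a function -/
noncomputable def cls {n : ℕ} : ((Fin n → ℂ) → ℂ) →ₐ[ℂ] GM n :=
  { clsR n with commutes' := fun _ => rfl }

theorem genU_le (n : ℕ) : (genU n : Filter (Fin n → ℂ)) ≤ gen n := Ultrafilter.of_le _

theorem cls_eq_iff {n : ℕ} {f g : (Fin n → ℂ) → ℂ} :
    cls f = cls g ↔ ∀ᶠ u in (genU n : Filter (Fin n → ℂ)), f u = g u :=
  Filter.Germ.coe_eq

theorem cls_zero {n : ℕ} {f : (Fin n → ℂ) → ℂ} (h : ∀ᶠ u in gen n, f u = 0) : cls f = 0 := by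
  rw [← map_zero cls, cls_eq_iff]
  exact genU_le n h

theorem cls_ne_zero {n : ℕ} {f : (Fin n → ℂ) → ℂ} (h : ∀ᶠ u in gen n, f u ≠ 0) : cls f ≠ 0 := by
  rw [← map_zero cls, Ne, cls_eq_iff]
  intro h2
  have h5 : ∀ᶠ u in (genU n : Filter (Fin n → ℂ)), f u ≠ 0 := genU_le n h
  obtain ⟨u, h3, h4⟩ := (h5.and h2).exists
  exact h3 h4

theorem gen_of_cls_zero {n : ℕ} {f : (Fin n → ℂ) → ℂ} (hf : Mero f) (h : cls f = 0) :
    ∀ᶠ u in gen n, f u = 0 :=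
  hf.dichot.resolve_right fun h2 => cls_ne_zero h2 h

theorem cls_aeval {n : ℕ} {σ : Type*} (F : σ → (Fin n → ℂ) → ℂ) (P : MvPolynomial σ ℂ) :
    aeval (fun i => cls (F i)) P = cls (fun u => eval (fun i => F i u) P) := by
  have h1 : (fun u => eval (fun i => F i u) P) = aeval F P := by
    induction P using MvPolynomial.induction_on with
    | C a => ext u; simp
    | add p q hp hq => ext u; simp [← hp, ← hq]
    | mul_X p i hp => ext u; simp [← hp]
  rw [h1]
  have h2 : cls.comp (aeval F) = aeval (R := ℂ) (fun i => cls (F i)) := by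
    ext i; simp
  exact (DFunLike.congr_fun h2 P).symm

theorem cls_const {n : ℕ} (a : ℂ) : cls (fun _ : Fin n → ℂ => a) = algebraMap ℂ (GM n) a := rfl

theorem aeval_mem {k M σ : Type*} [Field k] [Field M] [Algebra k M] {K : IntermediateField k M}
    (L : IntermediateField K M) (z : σ → M) (hz : ∀ i, z i ∈ L) (P : MvPolynomial σ k) :
    aeval z P ∈ L := by
  induction P using MvPolynomial.induction_on with
  | C a =>
    rw [← MvPolynomial.algebraMap_eq, AlgHom.commutes, IsScalarTower.algebraMap_apply k K M]
    exact L.algebraMap_mem _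
  | add p q hp hq => rw [map_add]; exact add_mem hp hq
  | mul_X p i hp => rw [map_mul, aeval_X]; exact mul_mem hp (hz i)

/-- functional version of `aarg` -/
def farg {n : ℕ} (t : (Fin n → ℂ) → ℂ) (x y : Fin n → (Fin n → ℂ) → ℂ) :
    Option (Fin n ⊕ Fin n) → (Fin n → ℂ) → ℂ :=
  fun i => i.elim t (Sum.elim x y)

theorem farg_apply {n : ℕ} (t : (Fin n → ℂ) → ℂ) (x y : Fin n → (Fin n → ℂ) → ℂ) (u : Fin n → ℂ) :
    (fun i => farg t x y i u) = aarg (t u) (fun j => x j u) (fun j => y j u) := by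
  ext i
  rcases i with _ | (i | i) <;> rfl

theorem farg_all {n : ℕ} {C : ((Fin n → ℂ) → ℂ) → Prop}
    {t : (Fin n → ℂ) → ℂ} {x y : Fin n → (Fin n → ℂ) → ℂ}
    (ht : C t) (hx : ∀ j, C (x j)) (hy : ∀ j, C (y j)) : ∀ i, C (farg t x y i) := by
  rintro (_ | (i | i))
  · exact ht
  · exact hx i
  · exact hy i

theorem farg_gen_ne {n : ℕ} {t : (Fin n → ℂ) → ℂ} {x y : Fin n → (Fin n → ℂ) → ℂ}
    (ht : Mero t) (hx : ∀ j, Mero (x j)) (hy : ∀ j, Mero (y j)) {u : Fin n → ℂ}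
    (ht' : AnalyticAt ℂ t u) (hx' : ∀ j, AnalyticAt ℂ (x j) u) (hy' : ∀ j, AnalyticAt ℂ (y j) u)
    (P : MvPolynomial (Option (Fin n ⊕ Fin n)) ℂ)
    (hP : eval (aarg (t u) (fun j => x j u) (fun j => y j u)) P ≠ 0) :
    ∀ᶠ u in gen n, eval (aarg (t u) (fun j => x j u) (fun j => y j u)) P ≠ 0 := by
  have h1 := Mero.poly (farg t x y) (farg_all (C := Mero) ht hx hy) P
  have h2 := cont_poly (farg t x y) u
    (farg_all (C := fun f => ContinuousAt f u) ht'.continuousAt (fun j => (hx' j).continuousAt)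
      (fun j => (hy' j).continuousAt)) P
  simp only [farg_apply] at h1 h2
  exact h1.gen_ne h2 hP

/-- The differentiated addition theorem. -/
theorem diff_aat {n : ℕ} (φ : Fin n → (Fin n → ℂ) → ℂ) (k : Fin n)
    (G : MvPolynomial (Option (Fin n ⊕ Fin n)) ℂ)
    (hG : ∀ u v, Dom φ k u v →
        eval (aarg (φ k (u + v)) (fun j => φ j u) fun j => φ j v) G = 0)
    {u c : Fin n → ℂ} (hD : Dom φ k u c) (p : Fin n) :
    eval (aarg (φ k (u + c)) (fun j => φ j u) fun j => φ j c) (pderiv none G) *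
        pd (φ k) p (u + c) +
      ∑ j, eval (aarg (φ k (u + c)) (fun j => φ j u) fun j => φ j c)
        (pderiv (some (Sum.inr j)) G) * pd (φ j) p c = 0 := by
  obtain ⟨hu, hc, huc⟩ := hD
  have h1 := (chain_poly (farg (fun v => φ k (u + v)) (fun j _ => φ j u) φ) c
    (farg_all (C := fun f => DifferentiableAt ℂ f c) (ana_addLeft huc).differentiableAt
      (fun j => differentiableAt_const _) (fun j => (hc j).differentiableAt)) G p).2
  simp only [farg_apply] at h1
  have h2 : (fun v => eval (aarg (φ k (u + v)) (fun j => φ j u) fun j => φ j v) G) =ᶠ[𝓝 c]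
      fun _ => 0 := by
    have e1 : ∀ᶠ v in 𝓝 c, ∀ j, AnalyticAt ℂ (φ j) v :=
      eventually_all.2 fun j => (hc j).eventually_analyticAt
    have e2 : ∀ᶠ v in 𝓝 c, AnalyticAt ℂ (φ k) (u + v) :=
      (Continuous.tendsto (f := fun v : Fin n → ℂ => u + v) (by fun_prop) c).eventually
        huc.eventually_analyticAt
    filter_upwards [e1, e2] with v h3 h4
    exact hG u v ⟨hu, h3, h4⟩
  have h3 : pd (fun v => eval (aarg (φ k (u + v)) (fun j => φ j u) fun j => φ j v) G) p c = 0 := by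
    unfold pd
    rw [h2.fderiv_eq]
    simp
  rw [h3, Fintype.sum_option, Fintype.sum_sum_type] at h1
  have h4 : pd (fun v => φ k (u + v)) p c = pd (φ k) p (u + c) := by
    unfold pd
    rw [fderiv_comp_add_left]
  have h5 : ∀ j, pd (fun _ : Fin n → ℂ => φ j u) p c = 0 := by
    intro j
    unfold pd
    simp
  simp only [farg, Option.elim, Sum.elim_inl, Sum.elim_inr, h4, h5, mul_zero,
    Finset.sum_const_zero, zero_add] at h1
  exact h1.symm

theorem alg_pd {n : ℕ} (φ : Fin n → (Fin n → ℂ) → ℂ) (hmero : ∀ k, Mero (φ k))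
    (hindep : AnalyticallyIndep φ) (haat : AdmitsAAT φ) (k p : Fin n) :
    IsAlgebraic (IntermediateField.adjoin ℂ (Set.range fun j => cls (φ j))) (cls (pd (φ k) p)) := by
  set K := IntermediateField.adjoin ℂ (Set.range fun j => cls (φ j)) with hK
  have hbK : ∀ j, cls (φ j) ∈ K := fun j => IntermediateField.subset_adjoin _ _ ⟨j, rfl⟩
  obtain ⟨G, hG, u0, v0, hD, hne⟩ := min_poly φ hmero hindep haat k
  choose G' hdeg hG' using haat
  have hq : ∀ j, (optionEquivLeft ℂ _ (G' j)).leadingCoeff ≠ 0 := by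
    intro j h
    rw [Polynomial.leadingCoeff_eq_zero, map_eq_zero_iff _ (AlgEquiv.injective _)] at h
    have := hdeg j
    simp [h] at this
  choose u1 v1 hD1 hne1 using fun j => indep3 φ hmero hindep _ (hq j) j
  have hana : ∀ᶠ c in gen n, ∀ j, AnalyticAt ℂ (φ j) c :=
    eventually_all.2 fun j => (hmero j).analytic
  have E1 : ∀ᶠ c in gen n, eval (aarg (φ k (u0 + c)) (fun j => φ j u0) fun j => φ j c)
      (pderiv none G) ≠ 0 :=
    farg_gen_ne (t := fun c => φ k (u0 + c)) (x := fun j _ => φ j u0) (y := φ)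
      ((hmero k).addLeft u0) (fun j => Mero.const _) hmero (ana_addLeft hD.2.2)
      (fun j => analyticAt_const) hD.2.1 _ hne
  have E2 : ∀ᶠ c in gen n, AnalyticAt ℂ (φ k) (c + u0) :=
    (gen_tendsto_add u0).eventually (hmero k).analytic
  have E4 : ∀ᶠ c in gen n, ∀ j, AnalyticAt ℂ (φ j) (-c) := gen_tendsto_neg.eventually hana
  have E5 : ∀ᶠ c in gen n, ∀ j, eval (Sum.elim (fun i => φ i (u1 j)) fun i => φ i (-c))
      (optionEquivLeft ℂ _ (G' j)).leadingCoeff ≠ 0 := by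
    rw [eventually_all]
    intro j
    refine gen_tendsto_neg.eventually (p := fun c => eval (Sum.elim (fun i => φ i (u1 j))
      fun i => φ i c) (optionEquivLeft ℂ _ (G' j)).leadingCoeff ≠ 0) ?_
    have := farg_gen_ne (t := fun c => 0) (x := fun i _ => φ i (u1 j)) (y := φ) (u := v1 j)
      (Mero.const 0) (fun j => Mero.const _) hmero analyticAt_const (fun j => analyticAt_const)
      (hD1 j).2.1 (rename some (optionEquivLeft ℂ _ (G' j)).leadingCoeff)
      (by rw [eval_rename]; exact hne1 j)
    simp only [eval_rename] at this
    exact this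
  obtain ⟨c, c1, c2, c3, c4, c5⟩ := (E1.and (E2.and (hana.and (E4.and E5)))).exists
  rw [add_comm] at c2
  -- translates are algebraic
  let a : Fin n → GM n := fun j => cls (fun u => φ j (u + -c))
  have ha : ∀ j, IsAlgebraic K (a j) := by
    intro j
    let F : Fin n ⊕ Fin n → (Fin n → ℂ) → ℂ := Sum.elim φ fun i _ => φ i (-c)
    have hFe : ∀ u, (fun i => F i u) = Sum.elim (fun i => φ i u) fun i => φ i (-c) := by
      intro u; ext i; cases i <;> rfl
    refine alg_root K (fun i => cls (F i)) ?_ (a j) (G' j) ?_ ?_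
    · rintro (i | i)
      · exact hbK i
      · exact K.algebraMap_mem _
    · have h1 : (fun o : Option (Fin n ⊕ Fin n) => o.elim (a j) fun i => cls (F i)) =
          fun o => cls (farg (fun u => φ j (u + -c)) φ (fun i _ => φ i (-c)) o) := by
        ext o
        rcases o with _ | (i | i) <;> rfl
      rw [h1, cls_aeval]
      apply cls_zero
      simp only [farg_apply]
      filter_upwards [hana, (gen_tendsto_add (-c)).eventually (hmero j).analytic] with u hu huc
      exact hG' j u (-c) hu c4 huc
    · rw [cls_aeval]
      apply cls_ne_zero
      simp only [hFe]
      have := farg_gen_ne (t := fun c => 0) (x := φ) (y := fun i _ => φ i (-c)) (u := u1 j)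
        (Mero.const 0) hmero (fun j => Mero.const _) analyticAt_const (hD1 j).1
        (fun j => analyticAt_const)
        (rename some (optionEquivLeft ℂ _ (G' j)).leadingCoeff)
        (by rw [eval_rename]; exact c5 j)
      simp only [eval_rename] at this
      exact this
  -- the formula
  let L := algebraicClosure K (GM n)
  let W := farg (φ k) (fun j u => φ j (u + -c)) (fun j _ => φ j c)
  have hWL : ∀ i, cls (W i) ∈ L := by
    refine farg_all (C := fun f => cls f ∈ L) ?_ ?_ ?_
    · exact L.algebraMap_mem ⟨_, hbK k⟩
    · intro j
      exact mem_algebraicClosure_iff.2 (ha j)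
    · intro j
      exact L.algebraMap_mem ⟨_, K.algebraMap_mem (φ j c)⟩
  have hden : aeval (fun i => cls (W i)) (pderiv none G) ≠ 0 := by
    rw [cls_aeval]
    apply cls_ne_zero
    simp only [W, farg_apply]
    have h1 : ∀ᶠ u in gen n, eval (aarg (φ k (u + c)) (fun j => φ j u) fun j => φ j c)
        (pderiv none G) ≠ 0 :=
      farg_gen_ne (t := fun u => φ k (u + c)) (x := φ) (y := fun j _ => φ j c) (u := u0)
        ((hmero k).addRight c) hmero (fun j => Mero.const _) (ana_addRight c2)
        hD.1 (fun j => analyticAt_const) _ c1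
    have h2 := (gen_tendsto_add (-c)).eventually h1
    simpa using h2
  have hrel : aeval (fun i => cls (W i)) (pderiv none G) * cls (pd (φ k) p) +
      ∑ j, aeval (fun i => cls (W i)) (pderiv (some (Sum.inr j)) G) *
        cls (fun _ => pd (φ j) p c) = 0 := by
    simp only [cls_aeval, ← map_mul, ← map_sum, ← map_add]
    apply cls_zero
    simp only [W, farg_apply]
    have h1 : ∀ᶠ u in gen n, Dom φ k (u + -c) c := by
      filter_upwards [(gen_tendsto_add (-c)).eventually hana, hana] with u h2 h3
      exact ⟨h2, c3, by simpa using h3 k⟩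
    filter_upwards [h1] with u hu
    have := diff_aat φ k G hG hu p
    simpa using this
  have hmem : cls (pd (φ k) p) ∈ L := by
    have h1 := eq_neg_of_add_eq_zero_left hrel
    have h2 := eq_div_of_mul_eq hden ((mul_comm _ _).trans h1)
    rw [h2]
    refine div_mem (neg_mem (sum_mem fun j _ => mul_mem ?_ ?_)) ?_
    · exact aeval_mem L _ hWL _
    · exact L.algebraMap_mem ⟨_, K.algebraMap_mem (pd (φ j) p c)⟩
    · exact aeval_mem L _ hWL _
  exact mem_algebraicClosure_iff.1 hmem

theorem aat_primitive_element {n : ℕ} (hn : 1 ≤ n) (φ : Fin n → (Fin n → ℂ) → ℂ)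
    (hmero : ∀ k, Mero (φ k)) (hindep : AnalyticallyIndep φ) (haat : AdmitsAAT φ) :
    ∃ α : Fin n → Fin n → ℂ, ∃ θ : (Fin n → ℂ) → ℂ,
      (∀ u, θ u = ∑ k : Fin n, ∑ p : Fin n, α k p * pd (φ k) p u) ∧
      (∃ V : MvPolynomial (Option (Fin n)) ℂ, V ≠ 0 ∧
        ∀ u : Fin n → ℂ, (∀ j, AnalyticAt ℂ (φ j) u) →
          (∀ j p, AnalyticAt ℂ (pd (φ j) p) u) →
          eval (tval θ φ u) V = 0) ∧
      ∀ k p : Fin n, ∃ A B : MvPolynomial (Option (Fin n)) ℂ,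
        (∃ u : Fin n → ℂ, (∀ j, AnalyticAt ℂ (φ j) u) ∧
          (∀ j q, AnalyticAt ℂ (pd (φ j) q) u) ∧ eval (tval θ φ u) B ≠ 0) ∧
        ∀ u : Fin n → ℂ, (∀ j, AnalyticAt ℂ (φ j) u) →
          (∀ j q, AnalyticAt ℂ (pd (φ j) q) u) → eval (tval θ φ u) B ≠ 0 →
          pd (φ k) p u = eval (tval θ φ u) A / eval (tval θ φ u) B := by

  obtain ⟨α, hα⟩ := alg_prim (k := ℂ) (fun j => cls (φ j))
    (fun i : Fin n × Fin n => cls (pd (φ i.1) i.2))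
    (fun i => alg_pd φ hmero hindep haat i.1 i.2)
  let θ : (Fin n → ℂ) → ℂ := fun u => ∑ k : Fin n, ∑ p : Fin n, α (k, p) * pd (φ k) p u
  have hθm : Mero θ :=
    Mero.sum _ _ fun k => Mero.sum _ _ fun p => (Mero.const (α (k, p))).mul ((hmero k).pd p)
  have hθc : cls θ = ∑ i : Fin n × Fin n, α i • cls (pd (φ i.1) i.2) := by
    simp only [← map_smul, ← map_sum]
    congr 1
    ext u
    simp [θ, Fintype.sum_prod_type]
  rw [← hθc] at hα
  let F : Option (Fin n) → (Fin n → ℂ) → ℂ := fun o => o.elim θ φ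
  have hFe : ∀ u, (fun i => F i u) = tval θ φ u := by
    intro u; ext i; cases i <;> rfl
  have hFc : (fun o : Option (Fin n) => o.elim (cls θ) fun j => cls (φ j)) =
      fun o => cls (F o) := by
    ext o; cases o <;> rfl
  have hFm : ∀ i, Mero (F i) := by
    rintro (_ | j)
    · exact hθm
    · exact hmero j
  have hpm : ∀ P, Mero (fun u => eval (tval θ φ u) P) := by
    intro P
    have := Mero.poly F hFm P
    simpa only [hFe] using this
  have hpc : ∀ P u, (∀ j, AnalyticAt ℂ (φ j) u) → (∀ j q, AnalyticAt ℂ (pd (φ j) q) u) →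
      ContinuousAt (fun u => eval (tval θ φ u) P) u := by
    intro P u hu hpu
    have := cont_poly F u (by
      rintro (_ | j)
      · have : ContinuousAt (fun u => ∑ k : Fin n, ∑ p : Fin n, α (k, p) * pd (φ k) p u) u :=
          tendsto_finsetSum _ fun k _ => tendsto_finsetSum _ fun p _ =>
            (hpu k p).continuousAt.const_mul _
        exact this
      · exact (hu j).continuousAt) P
    simpa only [hFe] using this
  have hcl : ∀ P, aeval (fun o : Option (Fin n) => o.elim (cls θ) fun j => cls (φ j)) P =
      cls (fun u => eval (tval θ φ u) P) := by
    intro P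
    rw [hFc, cls_aeval]
    simp only [hFe]
  refine ⟨fun k p => α (k, p), θ, fun u => rfl, ?_, ?_⟩
  · have hθa : IsAlgebraic (IntermediateField.adjoin ℂ (Set.range fun j => cls (φ j))) (cls θ) := by
      rw [← mem_algebraicClosure_iff, hθc]
      refine sum_mem fun i _ => ?_
      rw [Algebra.smul_def]
      refine mul_mem ?_ (mem_algebraicClosure_iff.2 (alg_pd φ hmero hindep haat i.1 i.2))
      exact IntermediateField.algebraMap_mem _
        (⟨_, IntermediateField.algebraMap_mem _ (α i)⟩ :
          IntermediateField.adjoin ℂ (Set.range fun j => cls (φ j)))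
    obtain ⟨V, hV, hV0⟩ := alg_dep_s4 _ _ hθa
    refine ⟨V, hV, fun u hu hpu => ?_⟩
    rw [hcl] at hV0
    exact gen_zero (gen_of_cls_zero (hpm V) hV0) (hpc V u hu hpu)
  · intro k p
    obtain ⟨A, B, hAB⟩ := (IntermediateField.mem_adjoin_range_iff _ _ _).1 (hα (k, p))
    rw [hcl, hcl] at hAB
    obtain ⟨A, B, hB, hAB⟩ : ∃ A B : MvPolynomial (Option (Fin n)) ℂ,
        cls (fun u => eval (tval θ φ u) B) ≠ 0 ∧ cls (pd (φ k) p) =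
          cls (fun u => eval (tval θ φ u) A) / cls (fun u => eval (tval θ φ u) B) := by
      by_cases hB : cls (fun u => eval (tval θ φ u) B) = 0
      · refine ⟨0, 1, ?_, ?_⟩
        · apply cls_ne_zero; simp
        · rw [hB, div_zero] at hAB
          have : cls (fun u => eval (tval θ φ u) 0) = 0 := cls_zero (by simp)
          rw [this, zero_div]
          exact hAB
      · exact ⟨A, B, hB, hAB⟩
    refine ⟨A, B, ?_, ?_⟩
    · have h1 : ∀ᶠ u in gen n, eval (tval θ φ u) B ≠ 0 :=
        (hpm B).dichot.resolve_left fun h => hB (cls_zero h)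
      have h2 : ∀ᶠ u in gen n, ∀ j, AnalyticAt ℂ (φ j) u :=
        Filter.eventually_all.2 fun j => (hmero j).analytic
      have h3 : ∀ᶠ u in gen n, ∀ j q, AnalyticAt ℂ (pd (φ j) q) u :=
        Filter.eventually_all.2 fun j => Filter.eventually_all.2 fun q => ((hmero j).pd q).analytic
      obtain ⟨u, hu1, hu2, hu3⟩ := (h1.and (h2.and h3)).exists
      exact ⟨u, hu2, hu3, hu1⟩
    · intro u hu hpu hBu
      rw [eq_div_iff hBu]
      rw [eq_div_iff hB, ← sub_eq_zero, ← map_mul, ← map_sub] at hAB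
      have h1 := gen_of_cls_zero (((((hmero k).pd p).mul (hpm B)).sub (hpm A))) hAB
      have h2 := gen_zero h1 (u := u)
        (((hpu k p).continuousAt.mul (hpc B u hu hpu)).sub (hpc A u hu hpu))
      exact sub_eq_zero.1 h2
end
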